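/- Let A be a dg algebra concentrated in non-negative degrees with H_i(A) = 0 for i ≫ 0. Then H_0(A) is proxy small in D(A) if and only if H_0(A) finitely builds A, i.e., A lies in the thick subcategory of D(A) generated by H_0(A). -/

import Mathlib

/-!
STATEMENT 12: Let `A` be a dg algebra concentrated in non-negative degrees with
`H_i(A) = 0` for `i ≫ 0`.  Then `H₀(A)` is proxy small in `D(A)` iff `H₀(A)`
finitely builds `A`.

Encodings: dg algebras/modules are rings/modules with internal `ℤ`-gradings and
degree `-1` differentials; thick (resp. localizing) subcategories of `D(A)` are
encoded by predicates on dg modules closed under quasi-isomorphism, suspension,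
short exact sequences, homotopy retracts (resp. and coproducts); small objects
of `D(A)` are those finitely built from `A` (paper, 1.2); `M` is proxy small if
there is a small `K` with `M` finitely building `K` and `K` building `M`.
-/

open DirectSum

/-- A dg algebra structure on a ring `A`. -/
structure IsDGAlgebra (A : Type) [Ring A] (𝒜 : ℤ → AddSubgroup A)
    (dA : A →+ A) : Prop where
  internal : DirectSum.IsInternal 𝒜
  one_mem : (1 : A) ∈ 𝒜 0
  mul_mem : ∀ {i j : ℤ} {a b : A}, a ∈ 𝒜 i → b ∈ 𝒜 j → a * b ∈ 𝒜 (i + j)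
  d_mem : ∀ {i : ℤ} {a : A}, a ∈ 𝒜 i → dA a ∈ 𝒜 (i - 1)
  d_sq : ∀ a, dA (dA a) = 0
  leibniz : ∀ {i : ℤ} (a b : A), a ∈ 𝒜 i →
    dA (a * b) = dA a * b + (((-1 : ℤˣ) ^ i : ℤˣ) : ℤ) • (a * dA b)

/-- A dg module over the dg algebra `(A, 𝒜, dA)`. -/
structure DGMod (A : Type) [Ring A] (𝒜 : ℤ → AddSubgroup A) (dA : A →+ A) where
  M : Type
  [addCommGroup : AddCommGroup M]
  [module : Module A M]
  ℳ : ℤ → AddSubgroup M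
  d : M →+ M
  internal : DirectSum.IsInternal ℳ
  smul_mem : ∀ {i j : ℤ} {a : A} {m : M}, a ∈ 𝒜 i → m ∈ ℳ j → a • m ∈ ℳ (i + j)
  d_mem : ∀ {i : ℤ} {m : M}, m ∈ ℳ i → d m ∈ ℳ (i - 1)
  d_sq : ∀ m, d (d m) = 0
  leibniz : ∀ {i : ℤ} (a : A) (m : M), a ∈ 𝒜 i →
    d (a • m) = dA a • m + (((-1 : ℤˣ) ^ i : ℤˣ) : ℤ) • (a • d m)

attribute [instance] DGMod.addCommGroup DGMod.module

variable {A : Type} [Ring A] {𝒜 : ℤ → AddSubgroup A} {dA : A →+ A}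

/-- A morphism of dg modules. -/
structure DGHom (M N : DGMod A 𝒜 dA) where
  toFun : M.M →ₗ[A] N.M
  mem : ∀ {i : ℤ} {m : M.M}, m ∈ M.ℳ i → toFun m ∈ N.ℳ i
  comm : ∀ m, toFun (M.d m) = N.d (toFun m)

/-- Vanishing of the `i`-th homology of a dg module. -/
def HVanish (M : DGMod A 𝒜 dA) (i : ℤ) : Prop :=
  M.ℳ i ⊓ M.d.ker ≤ AddSubgroup.map M.d (M.ℳ (i + 1))

/-- Quasi-isomorphisms of dg modules, expressed elementwise. -/
def IsQuasiIso {M N : DGMod A 𝒜 dA} (f : DGHom M N) : Prop :=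
  (∀ (i : ℤ) (z : N.M), z ∈ N.ℳ i → N.d z = 0 →
    ∃ z' w, z' ∈ M.ℳ i ∧ M.d z' = 0 ∧ w ∈ N.ℳ (i + 1) ∧
      f.toFun z' = z + N.d w) ∧
  (∀ (i : ℤ) (z : M.M), z ∈ M.ℳ i → M.d z = 0 →
    (∃ w, w ∈ N.ℳ (i + 1) ∧ f.toFun z = N.d w) →
    ∃ v, v ∈ M.ℳ (i + 1) ∧ z = M.d v)

/-- `N` is a suspension (shift) of `M`. -/
def IsSuspension (M N : DGMod A 𝒜 dA) : Prop :=
  ∃ e : M.M ≃+ N.M,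
    (∀ i, AddSubgroup.map e.toAddMonoidHom (M.ℳ i) = N.ℳ (i + 1)) ∧
    (∀ m, e (M.d m) = - N.d (e m)) ∧
    (∀ {i : ℤ} (a : A) (m : M.M), a ∈ 𝒜 i →
      e (a • m) = (((-1 : ℤˣ) ^ i : ℤˣ) : ℤ) • (a • e m))

/-- A short exact sequence of dg modules. -/
def IsShortExactSeq {M₁ M₂ M₃ : DGMod A 𝒜 dA}
    (f : DGHom M₁ M₂) (g : DGHom M₂ M₃) : Prop :=
  Function.Injective f.toFun ∧ Function.Surjective g.toFun ∧
    ∀ x, g.toFun x = 0 ↔ ∃ y, f.toFun y = x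

/-- `C` is a coproduct (direct sum) of the family `F`. -/
def IsCoproductOf {ι : Type} (F : ι → DGMod A 𝒜 dA) (C : DGMod A 𝒜 dA) : Prop :=
  ∃ φ : ∀ i, DGHom (F i) C,
    (∀ i, Function.Injective (φ i).toFun) ∧
    (⨆ i, LinearMap.range (φ i).toFun) = ⊤ ∧
    iSupIndep fun i => LinearMap.range (φ i).toFun

/-- `N` is a homotopy retract of `X`. -/
def IsHtpyRetract (N X : DGMod A 𝒜 dA) : Prop :=
  ∃ (ii : DGHom N X) (r : DGHom X N) (h : N.M →+ N.M),
    (∀ {j : ℤ} {m : N.M}, m ∈ N.ℳ j → h m ∈ N.ℳ (j + 1)) ∧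
    ∀ m, r.toFun (ii.toFun m) - m = N.d (h m) + h (N.d m)

/-- Membership predicate of a thick subcategory of `D(A)`. -/
structure IsThickClass (P : DGMod A 𝒜 dA → Prop) : Prop where
  qis : ∀ {M N} (f : DGHom M N), IsQuasiIso f → (P M ↔ P N)
  susp : ∀ {M N}, IsSuspension M N → (P M ↔ P N)
  ext₁ : ∀ {M₁ M₂ M₃} (f : DGHom M₁ M₂) (g : DGHom M₂ M₃),
    IsShortExactSeq f g → P M₂ → P M₃ → P M₁
  ext₂ : ∀ {M₁ M₂ M₃} (f : DGHom M₁ M₂) (g : DGHom M₂ M₃),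
    IsShortExactSeq f g → P M₁ → P M₃ → P M₂
  ext₃ : ∀ {M₁ M₂ M₃} (f : DGHom M₁ M₂) (g : DGHom M₂ M₃),
    IsShortExactSeq f g → P M₁ → P M₂ → P M₃
  retract : ∀ {N X}, IsHtpyRetract N X → P X → P N

/-- Membership predicate of a localizing subcategory of `D(A)`. -/
structure IsLocalizingClass (P : DGMod A 𝒜 dA → Prop) extends
    IsThickClass P : Prop where
  coprod : ∀ {ι : Type} (F : ι → DGMod A 𝒜 dA) (C : DGMod A 𝒜 dA),
    IsCoproductOf F C → (∀ i, P (F i)) → P C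

/-- `Z` builds `M` in `D(A)`. -/
def Builds (Z M : DGMod A 𝒜 dA) : Prop :=
  ∀ P : DGMod A 𝒜 dA → Prop, IsLocalizingClass P → P Z → P M

/-- `Z` finitely builds `M` in `D(A)`. -/
def FinBuilds (Z M : DGMod A 𝒜 dA) : Prop :=
  ∀ P : DGMod A 𝒜 dA → Prop, IsThickClass P → P Z → P M

/-- `A` as a dg module over itself. -/
def aMod (hA : IsDGAlgebra A 𝒜 dA) : DGMod A 𝒜 dA where
  M := A
  ℳ := 𝒜
  d := dA
  internal := hA.internal
  smul_mem := fun ha hm => by simpa [smul_eq_mul] using hA.mul_mem ha hm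
  d_mem := hA.d_mem
  d_sq := hA.d_sq
  leibniz := fun a m ha => by simpa [smul_eq_mul] using hA.leibniz a m ha

/-- `Z` is a model of `H₀(A)` viewed as a dg `A`-module via the augmentation:
`Z` is concentrated in degree `0` with zero differential, and receives a dg map
from `A` which is surjective with kernel the boundaries in degree `0`. -/
def IsHZero (hA : IsDGAlgebra A 𝒜 dA) (Z : DGMod A 𝒜 dA) : Prop :=
  (∀ i : ℤ, i ≠ 0 → Z.ℳ i = ⊥) ∧ Z.d = 0 ∧
  ∃ π : DGHom (aMod hA) Z, Function.Surjective π.toFun ∧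
    ∀ x ∈ 𝒜 (0 : ℤ), (π.toFun x = 0 ↔ ∃ y ∈ 𝒜 (1 : ℤ), dA y = x)

/-- Proxy smallness in `D(A)`: there is a small object `K` (one finitely built
from `A`) finitely built from `M` and building `M`. -/
def IsProxySmall (hA : IsDGAlgebra A 𝒜 dA) (M : DGMod A 𝒜 dA) : Prop :=
  ∃ K : DGMod A 𝒜 dA, FinBuilds (aMod hA) K ∧ FinBuilds M K ∧ Builds K M

noncomputable section
namespace DGX
open DirectSum

/-- sign -/
def sgn (i : ℤ) : ℤ := (((-1 : ℤˣ) ^ i : ℤˣ) : ℤ)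

lemma sgn_add (i j : ℤ) : sgn (i + j) = sgn i * sgn j := by
  simp [sgn, zpow_add]

@[simp] lemma sgn_one : sgn 1 = -1 := by simp [sgn]
@[simp] lemma sgn_zero : sgn 0 = 1 := by simp [sgn]
@[simp] lemma sgn_neg_one : sgn (-1) = -1 := by simp [sgn]
lemma sgn_mul_self (i : ℤ) : sgn i * sgn i = 1 := by
  have := Int.units_mul_self ((-1 : ℤˣ) ^ i)
  simpa [sgn] using congrArg (Units.val) this
lemma sgn_sub_one (i : ℤ) : sgn (i - 1) = - sgn i := by
  rw [sub_eq_add_neg, sgn_add]; simp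
lemma sgn_add_one (i : ℤ) : sgn (i + 1) = - sgn i := by
  rw [sgn_add]; simp
lemma sgn_cases (i : ℤ) : sgn i = 1 ∨ sgn i = -1 := by
  have := sgn_mul_self i
  exact mul_self_eq_one_iff.mp this

/-- Criterion for internal gradings. -/
lemma internal_of {M : Type} [AddCommGroup M] (ℳ : ℤ → AddSubgroup M) (p : ℤ → M →+ M)
    (h1 : ∀ i x, x ∈ ℳ i → p i x = x) (h2 : ∀ i j x, x ∈ ℳ i → i ≠ j → p j x = 0)
    (h3 : ∀ x, x ∈ ⨆ i, ℳ i) : DirectSum.IsInternal ℳ := by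
  have key : ∀ (y : ⨁ i, ℳ i) (j : ℤ), p j (DirectSum.coeAddMonoidHom ℳ y) = (y j : M) := by
    intro y j
    induction y using DirectSum.induction_on with
    | zero => simp
    | of i x =>
      rw [DirectSum.coeAddMonoidHom_of]
      by_cases h : i = j
      · subst h; rw [h1 _ _ x.2, DirectSum.of_eq_same]
      · rw [h2 i j _ x.2 h, DirectSum.of_eq_of_ne _ _ _ (Ne.symm h)]; simp
    | add x y hx hy => simp [hx, hy]
  constructor
  · rw [injective_iff_map_eq_zero]
    intro y hy
    ext j
    rw [← key y j, hy]; simp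
  · intro x
    have := h3 x
    induction this using AddSubgroup.iSup_induction' with
    | hp i x hx => exact ⟨DirectSum.of (fun i => ℳ i) i ⟨x, hx⟩, by simp⟩
    | h1 => exact ⟨0, by simp⟩
    | hadd x y _ _ hx hy =>
      obtain ⟨a, rfl⟩ := hx
      obtain ⟨b, rfl⟩ := hy
      exact ⟨a + b, by simp⟩


/-- decomposition equivalence -/
def dec {M : Type} [AddCommGroup M] {ℳ : ℤ → AddSubgroup M} (h : DirectSum.IsInternal ℳ) :
    (⨁ i, ℳ i) ≃+ M := AddEquiv.ofBijective (DirectSum.coeAddMonoidHom ℳ) h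

/-- projection -/
def gp {M : Type} [AddCommGroup M] {ℳ : ℤ → AddSubgroup M} (h : DirectSum.IsInternal ℳ) (i : ℤ) :
    M →+ M where
  toFun m := ((dec h).symm m i : M)
  map_zero' := by simp
  map_add' := by simp

lemma dec_symm {M : Type} [AddCommGroup M] {ℳ : ℤ → AddSubgroup M} (h : DirectSum.IsInternal ℳ)
    {i : ℤ} {m : M} (hm : m ∈ ℳ i) :
    (dec h).symm m = DirectSum.of (fun i => ℳ i) i ⟨m, hm⟩ := by
  rw [AddEquiv.symm_apply_eq]
  exact (DirectSum.coeAddMonoidHom_of ℳ i ⟨m, hm⟩).symm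

lemma gp_same {M : Type} [AddCommGroup M] {ℳ : ℤ → AddSubgroup M} (h : DirectSum.IsInternal ℳ)
    {i : ℤ} {m : M} (hm : m ∈ ℳ i) : gp h i m = m := by
  show ((dec h).symm m i : M) = m
  rw [dec_symm h hm, DirectSum.of_eq_same]

lemma gp_ne {M : Type} [AddCommGroup M] {ℳ : ℤ → AddSubgroup M} (h : DirectSum.IsInternal ℳ)
    {i j : ℤ} {m : M} (hm : m ∈ ℳ i) (hij : i ≠ j) : gp h j m = 0 := by
  show ((dec h).symm m j : M) = 0
  rw [dec_symm h hm, DirectSum.of_eq_of_ne _ _ _ (Ne.symm hij)]; simp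

lemma gp_mem {M : Type} [AddCommGroup M] {ℳ : ℤ → AddSubgroup M} (h : DirectSum.IsInternal ℳ)
    (i : ℤ) (m : M) : gp h i m ∈ ℳ i := ((dec h).symm m i).2

lemma gr_induction {M : Type} [AddCommGroup M] {ℳ : ℤ → AddSubgroup M}
    (h : DirectSum.IsInternal ℳ) {C : M → Prop} (hh : ∀ i m, m ∈ ℳ i → C m)
    (ha : ∀ x y, C x → C y → C (x + y)) (m : M) : C m := by
  obtain ⟨y, rfl⟩ := h.2 m
  induction y using DirectSum.induction_on with
  | zero => rw [map_zero]; exact hh 0 _ (zero_mem _)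
  | of i x => rw [DirectSum.coeAddMonoidHom_of]; exact hh i _ x.2
  | add x y hx hy => rw [map_add]; exact ha _ _ hx hy

lemma gr_sum {M : Type} [AddCommGroup M] {ℳ : ℤ → AddSubgroup M}
    (h : DirectSum.IsInternal ℳ) (m : M) :
    ∃ s : Finset ℤ, (∀ t : Finset ℤ, s ⊆ t → m = ∑ i ∈ t, gp h i m) := by
  classical
  induction m using gr_induction h with
  | hh i m hm =>
    refine ⟨{i}, fun t ht => ?_⟩
    rw [Finset.sum_eq_single i]
    · exact (gp_same h hm).symm
    · intro j _ hj; exact gp_ne h hm (Ne.symm hj)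
    · intro hi; exact absurd (ht (by simp)) hi
  | ha x y hx hy =>
    obtain ⟨s, hs⟩ := hx
    obtain ⟨s', hs'⟩ := hy
    refine ⟨s ∪ s', fun t ht => ?_⟩
    conv_lhs => rw [hs t (Finset.union_subset_left ht), hs' t (Finset.union_subset_right ht)]
    simp [Finset.sum_add_distrib]

lemma gr_ext {M N : Type} [AddCommGroup M] {ℳ : ℤ → AddSubgroup M} [AddCommGroup N]
    (h : DirectSum.IsInternal ℳ) (f g : M →+ N) (hfg : ∀ i m, m ∈ ℳ i → f m = g m) (m : M) :
    f m = g m := by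
  induction m using gr_induction h with
  | hh i m hm => exact hfg i m hm
  | ha x y hx hy => simp [hx, hy]

lemma eq_zero_of_gp {M : Type} [AddCommGroup M] {ℳ : ℤ → AddSubgroup M}
    (h : DirectSum.IsInternal ℳ) (m : M) (hm : ∀ i, gp h i m = 0) : m = 0 := by
  obtain ⟨s, hs⟩ := gr_sum h m
  rw [hs s (le_refl _)]; simp [hm]

lemma mem_iSup_of_internal {M : Type} [AddCommGroup M] {ℳ : ℤ → AddSubgroup M}
    (h : DirectSum.IsInternal ℳ) (m : M) : m ∈ ⨆ i, ℳ i := by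
  induction m using gr_induction h with
  | hh i m hm => exact AddSubgroup.mem_iSup_of_mem i hm
  | ha x y hx hy => exact add_mem hx hy

/-- sign operator -/
def gs {M : Type} [AddCommGroup M] {ℳ : ℤ → AddSubgroup M} (h : DirectSum.IsInternal ℳ) :
    M →+ M :=
  (DirectSum.toAddMonoid (fun i => sgn i • (ℳ i).subtype)).comp (dec h).symm.toAddMonoidHom

lemma gs_mem {M : Type} [AddCommGroup M] {ℳ : ℤ → AddSubgroup M} (h : DirectSum.IsInternal ℳ)
    {i : ℤ} {m : M} (hm : m ∈ ℳ i) : gs h m = sgn i • m := by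
  simp [gs, dec_symm h hm]

/-- projection for dg modules -/
def p (M : DGMod A 𝒜 dA) (i : ℤ) : M.M →+ M.M := gp M.internal i
/-- sign operator for dg modules -/
def ε (M : DGMod A 𝒜 dA) : M.M →+ M.M := gs M.internal

lemma ε_mem (M : DGMod A 𝒜 dA) {i : ℤ} {m : M.M} (hm : m ∈ M.ℳ i) : ε M m = sgn i • m :=
  gs_mem _ hm

lemma leib (M : DGMod A 𝒜 dA) {i : ℤ} (a : A) (m : M.M) (ha : a ∈ 𝒜 i) :
    M.d (a • m) = dA a • m + sgn i • (a • M.d m) := M.leibniz a m ha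

lemma ε_ε (M : DGMod A 𝒜 dA) (m : M.M) : ε M (ε M m) = m := by
  refine gr_ext M.internal ((ε M).comp (ε M)) (AddMonoidHom.id _) ?_ m
  intro i m hm
  simp [ε_mem M hm, smul_smul, sgn_mul_self]

lemma ε_d (M : DGMod A 𝒜 dA) (m : M.M) : ε M (M.d m) = - M.d (ε M m) := by
  refine gr_ext M.internal ((ε M).comp M.d) (-(M.d.comp (ε M))) ?_ m
  intro i m hm
  simp [ε_mem M hm, ε_mem M (M.d_mem hm), sgn_sub_one]

lemma ε_smul (M : DGMod A 𝒜 dA) {i : ℤ} (a : A) (ha : a ∈ 𝒜 i) (m : M.M) :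
    ε M (a • m) = sgn i • a • ε M m := by
  refine gr_ext M.internal ((ε M).comp (DistribSMul.toAddMonoidHom _ a))
    (sgn i • ((DistribSMul.toAddMonoidHom _ a).comp (ε M))) ?_ m
  intro j m hm
  simp [ε_mem M hm, ε_mem M (M.smul_mem ha hm), sgn_add, mul_smul]
  rw [smul_comm a (sgn j) m]

lemma ε_mem_iff (M : DGMod A 𝒜 dA) {i : ℤ} {m : M.M} (hm : m ∈ M.ℳ i) : ε M m ∈ M.ℳ i := by
  rw [ε_mem M hm]; exact zsmul_mem hm _

/-- degree `n` linear maps -/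
def Deg (M N : DGMod A 𝒜 dA) (n : ℤ) (f : M.M →ₗ[A] N.M) : Prop :=
  ∀ i m, m ∈ M.ℳ i → f m ∈ N.ℳ (i + n)

/-- commutes with the differential -/
def Cm (M N : DGMod A 𝒜 dA) (f : M.M →ₗ[A] N.M) : Prop := ∀ m, f (M.d m) = N.d (f m)

/-- null-homotopic -/
def Null (M N : DGMod A 𝒜 dA) (n : ℤ) (f : M.M →ₗ[A] N.M) : Prop :=
  ∃ h : M.M →ₗ[A] N.M, Deg M N (n + 1) h ∧ ∀ m, f (ε M m) = N.d (h m) - h (M.d m)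

lemma p_d (M : DGMod A 𝒜 dA) (i : ℤ) (m : M.M) : p M i (M.d m) = M.d (p M (i + 1) m) := by
  refine gr_ext M.internal ((p M i).comp M.d) (M.d.comp (p M (i + 1))) ?_ m
  intro j m hm
  by_cases h : j = i + 1
  · have h2 : M.d m ∈ M.ℳ i := by simpa [h] using M.d_mem hm
    subst h
    simp [p, gp_same _ hm, gp_same _ h2]
  · have := gp_ne M.internal (M.d_mem hm) (j := i) (by omega)
    simp [p, gp_ne _ hm h, this]

lemma p_f {M N : DGMod A 𝒜 dA} {n : ℤ} {f : M.M →ₗ[A] N.M} (hf : Deg M N n f) (i : ℤ) (m : M.M) :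
    p N (i + n) (f m) = f (p M i m) := by
  refine gr_ext M.internal ((p N (i + n)).comp f.toAddMonoidHom)
    (f.toAddMonoidHom.comp (p M i)) ?_ m
  intro j m hm
  by_cases h : j = i
  · subst h
    simp [p, gp_same _ hm, gp_same _ (hf _ _ hm)]
  · have := gp_ne N.internal (hf _ _ hm) (j := i + n) (by omega)
    simp [p, gp_ne _ hm h, this]

lemma ε_f {M N : DGMod A 𝒜 dA} {n : ℤ} {f : M.M →ₗ[A] N.M} (hf : Deg M N n f) (m : M.M) :
    ε N (f m) = sgn n • f (ε M m) := by
  refine gr_ext M.internal ((ε N).comp f.toAddMonoidHom)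
    (sgn n • (f.toAddMonoidHom.comp (ε M))) ?_ m
  intro j m hm
  simp [ε_mem M hm, ε_mem N (hf _ _ hm), sgn_add, smul_smul, mul_comm]

lemma ε_f0 {M N : DGMod A 𝒜 dA} {f : M.M →ₗ[A] N.M} (hf : Deg M N 0 f) (m : M.M) :
    ε N (f m) = f (ε M m) := by simpa using ε_f hf m

/-- acyclic -/
def Acyc (N : DGMod A 𝒜 dA) : Prop := ∀ z, N.d z = 0 → ∃ w, N.d w = z

/-- ungraded quasi-isomorphism -/
def Qis (M N : DGMod A 𝒜 dA) (f : M.M →ₗ[A] N.M) : Prop :=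
  (∀ z, N.d z = 0 → ∃ z' w, M.d z' = 0 ∧ f z' = z + N.d w) ∧
  (∀ z, M.d z = 0 → (∃ w, f z = N.d w) → ∃ v, z = M.d v)

/-- bundle -/
def bun {M N : DGMod A 𝒜 dA} (f : M.M →ₗ[A] N.M) (h : Deg M N 0 f) (hc : Cm M N f) :
    DGHom M N := ⟨f, fun {i} {m} hm => by simpa using h i m hm, hc⟩

lemma deg_of (M N : DGMod A 𝒜 dA) (f : DGHom M N) : Deg M N 0 f.toFun :=
  fun i m hm => by simpa using f.mem hm

lemma exists_sum_lift {M : DGMod A 𝒜 dA} {C : M.M → Prop} (z : M.M)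
    (hC : ∀ i, C (p M i z)) (h0 : C 0) (ha : ∀ x y, C x → C y → C (x + y)) : C z := by
  classical
  obtain ⟨s, hs⟩ := gr_sum M.internal z
  rw [hs s le_rfl]
  exact Finset.sum_induction _ C ha h0 (fun i _ => hC i)

lemma qis_iff {M N : DGMod A 𝒜 dA} (f : DGHom M N) : IsQuasiIso f ↔ Qis M N f.toFun := by
  constructor
  · rintro ⟨h1, h2⟩
    constructor
    · intro z hz
      refine exists_sum_lift (M := N) (C := fun z => ∃ z' w, M.d z' = 0 ∧ f.toFun z' = z + N.d w)
        z ?_ ⟨0, 0, by simp⟩ ?_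
      · intro i
        obtain ⟨z', w, -, h, -, h'⟩ := h1 i (p N i z) (gp_mem _ _ _) (by
          have := p_d N (i - 1) z
          rw [hz] at this; simpa using this.symm)
        exact ⟨z', w, h, h'⟩
      · rintro x y ⟨a, b, h, h'⟩ ⟨a1, b1, h1, h1'⟩
        refine ⟨a + a1, b + b1, by simp [h, h1], ?_⟩
        simp only [map_add, h', h1']; abel
    · rintro z hz ⟨w, hw⟩
      refine exists_sum_lift (M := M) (C := fun z => ∃ v, z = M.d v) z ?_ ⟨0, by simp⟩ ?_
      · intro i
        obtain ⟨v, -, hv⟩ := h2 i (p M i z) (gp_mem _ _ _) (by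
          have := p_d M (i - 1) z
          rw [hz] at this; simpa using this.symm) ⟨p N (i + 1) w, gp_mem _ _ _, by
            rw [← p_d, ← hw, ← p_f (deg_of M N f)]; simp⟩
        exact ⟨v, hv⟩
      · rintro x y ⟨a, rfl⟩ ⟨b, rfl⟩
        exact ⟨a + b, by simp⟩
  · rintro ⟨h1, h2⟩
    constructor
    · intro i z hz hd
      obtain ⟨z', w, h, h'⟩ := h1 z hd
      refine ⟨p M i z', p N (i + 1) w, gp_mem _ _ _, ?_, gp_mem _ _ _, ?_⟩
      · have := p_d M (i - 1) z'
        rw [h] at this; simpa using this.symm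
      · rw [← p_d, ← p_f (deg_of M N f), h']
        simp [p, gp_same _ hz]
    · rintro i z hz hd ⟨w, -, hw⟩
      obtain ⟨v, hv⟩ := h2 z hd ⟨w, hw⟩
      refine ⟨p M (i + 1) v, gp_mem _ _ _, ?_⟩
      rw [← p_d, ← hv]; simp [p, gp_same _ hz]

end DGX
end

noncomputable section
namespace DGX
open DirectSum

/-- regrading: this is a model for the `n`-fold suspension -/
@[reducible] def shift (M : DGMod A 𝒜 dA) (n : ℤ) : DGMod A 𝒜 dA where
  M := M.M
  ℳ i := M.ℳ (i - n)
  d := M.d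
  internal := by
    refine internal_of _ (fun i => p M (i - n)) ?_ ?_ ?_
    · intro i x hx; exact gp_same _ hx
    · intro i j x hx hij; exact gp_ne _ hx (by omega)
    · intro x
      induction x using gr_induction M.internal with
      | hh i m hm =>
        exact AddSubgroup.mem_iSup_of_mem (i + n) (by simpa using hm)
      | ha x y hx hy => exact add_mem hx hy
  smul_mem := fun {i j a m} ha hm => by
    have := M.smul_mem ha hm
    rwa [← add_sub_assoc] at this
  d_mem := fun {i m} hm => by
    have := M.d_mem hm
    rwa [show i - n - 1 = i - 1 - n by ring] at this
  d_sq := M.d_sq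
  leibniz := M.leibniz

lemma ε_shift (M : DGMod A 𝒜 dA) (n : ℤ) (m : M.M) : ε (shift M n) m = sgn n • ε M m := by
  refine gr_ext M.internal (ε (shift M n)) (sgn n • ε M) ?_ m
  intro i m hm
  have : m ∈ (shift M n).ℳ (i + n) := by simpa using hm
  rw [ε_mem (shift M n) this]
  simp [ε_mem M hm, sgn_add, smul_smul, mul_comm]

/-- twisted extension -/
@[reducible] def ext (M N : DGMod A 𝒜 dA) (τ : M.M →ₗ[A] N.M) (hd : Deg M N (-1) τ)
    (hc : Cm M N τ) : DGMod A 𝒜 dA where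
  M := N.M × M.M
  ℳ i := (N.ℳ i).prod (M.ℳ i)
  d := ((N.d.comp (AddMonoidHom.fst _ _)) +
      τ.toAddMonoidHom.comp ((ε M).comp (AddMonoidHom.snd _ _))).prod
        (M.d.comp (AddMonoidHom.snd _ _))
  internal := by
    refine internal_of _ (fun i => (p N i).prodMap (p M i)) ?_ ?_ ?_
    · rintro i ⟨x, y⟩ ⟨hx, hy⟩
      exact Prod.ext (gp_same _ hx) (gp_same _ hy)
    · rintro i j ⟨x, y⟩ ⟨hx, hy⟩ hij
      exact Prod.ext (gp_ne _ hx hij) (gp_ne _ hy hij)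
    · rintro ⟨x, y⟩
      have h1 : ∀ x : N.M, ((x, 0) : N.M × M.M) ∈ ⨆ i, (N.ℳ i).prod (M.ℳ i) := by
        intro x
        induction x using gr_induction N.internal with
        | hh i m hm =>
          exact AddSubgroup.mem_iSup_of_mem i ⟨hm, zero_mem _⟩
        | ha x y hx hy => simpa using add_mem hx hy
      have h2 : ∀ x : M.M, ((0, x) : N.M × M.M) ∈ ⨆ i, (N.ℳ i).prod (M.ℳ i) := by
        intro x
        induction x using gr_induction M.internal with
        | hh i m hm =>
          exact AddSubgroup.mem_iSup_of_mem i ⟨zero_mem _, hm⟩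
        | ha x y hx hy => simpa using add_mem hx hy
      simpa using add_mem (h1 x) (h2 y)
  smul_mem := by
    rintro i j a ⟨x, y⟩ ha ⟨hx, hy⟩
    exact ⟨N.smul_mem ha hx, M.smul_mem ha hy⟩
  d_mem := by
    rintro i ⟨x, y⟩ ⟨hx, hy⟩
    exact ⟨add_mem (N.d_mem hx) (hd _ _ (ε_mem_iff M hy)), M.d_mem hy⟩
  d_sq := by
    rintro ⟨x, y⟩
    refine Prod.ext ?_ (M.d_sq y)
    show N.d (N.d x + τ (ε M y)) + τ (ε M (M.d y)) = 0
    rw [map_add, N.d_sq, ε_d, map_neg, hc]; simp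
  leibniz := by
    rintro i a ⟨x, y⟩ ha
    refine Prod.ext ?_ (M.leibniz a y ha)
    show N.d (a • x) + τ (ε M (a • y)) = dA a • x + sgn i • (a • (N.d x + τ (ε M y)))
    rw [leib N a x ha, ε_smul M a ha, map_zsmul, map_smul, smul_add, smul_add, add_assoc]

lemma ext_d (M N : DGMod A 𝒜 dA) (τ : M.M →ₗ[A] N.M) (hd : Deg M N (-1) τ)
    (hc : Cm M N τ) (x : N.M) (y : M.M) :
    (ext M N τ hd hc).d (x, y) = (N.d x + τ (ε M y), M.d y) := rfl

lemma ε_ext (M N : DGMod A 𝒜 dA) (τ : M.M →ₗ[A] N.M) (hd : Deg M N (-1) τ)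
    (hc : Cm M N τ) (x : N.M) (y : M.M) :
    ε (ext M N τ hd hc) (x, y) = (ε N x, ε M y) := by
  refine gr_ext (ext M N τ hd hc).internal (ε (ext M N τ hd hc)) ((ε N).prodMap (ε M)) ?_ (x, y)
  rintro i ⟨x, y⟩ h
  rw [ε_mem _ h]
  exact Prod.ext (ε_mem N h.1).symm (ε_mem M h.2).symm

section coprod
variable {ι : Type} (F : ι → DGMod A 𝒜 dA)

open Classical in
/-- coproduct -/
@[reducible] def coprod : DGMod A 𝒜 dA where
  M := Π₀ i, (F i).M
  ℳ k := 
    { carrier := {x | ∀ i, x i ∈ (F i).ℳ k}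
      zero_mem' := fun i => zero_mem _
      add_mem' := fun hx hy i => add_mem (hx i) (hy i)
      neg_mem' := fun hx i => neg_mem (hx i) }
  d := DFinsupp.mapRange.addMonoidHom (fun i => (F i).d)
  internal := by
    refine internal_of _ (fun k => DFinsupp.mapRange.addMonoidHom (fun i => p (F i) k)) ?_ ?_ ?_
    · intro k x hx
      ext i
      exact gp_same _ (hx i)
    · intro k j x hx hij
      ext i
      exact gp_ne _ (hx i) hij
    · intro x
      induction x using DFinsupp.induction with
      | h0 => exact zero_mem _
      | ha i b f hfi hb hf =>
        refine add_mem ?_ hf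
        clear hb
        induction b using gr_induction (F i).internal with
        | hh k m hm =>
          refine AddSubgroup.mem_iSup_of_mem k ?_
          intro j
          by_cases h : i = j
          · subst h; simpa using hm
          · rw [DFinsupp.single_eq_of_ne (Ne.symm h)]; exact zero_mem _
        | ha x y hx hy => rw [DFinsupp.single_add]; exact add_mem hx hy
  smul_mem := fun {k j a m} ha hm i => (F i).smul_mem ha (hm i)
  d_mem := fun {k m} hm i => (F i).d_mem (hm i)
  d_sq := by
    intro x; ext i; exact (F i).d_sq _
  leibniz := by
    intro k a m ha
    ext i
    exact (F i).leibniz a (m i) ha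

open Classical in
/-- inclusion -/
def inc (i : ι) : (F i).M →ₗ[A] (coprod F).M :=
  DFinsupp.lsingle (R := A) (M := fun i => (F i).M) i

/-- projection -/
def prj (i : ι) : (coprod F).M →ₗ[A] (F i).M := DFinsupp.lapply i

open Classical in
/-- universal map -/
def desc (N : DGMod A 𝒜 dA) (f : ∀ i, (F i).M →ₗ[A] N.M) : (coprod F).M →ₗ[A] N.M :=
  DFinsupp.lsum ℕ f

@[simp] lemma desc_inc (N : DGMod A 𝒜 dA) (f : ∀ i, (F i).M →ₗ[A] N.M) (i : ι) (x : (F i).M) :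
    desc F N f (inc F i x) = f i x := by
  classical
  simp [desc, inc]

lemma cop_induction {C : (coprod F).M → Prop} (h0 : C 0) (hi : ∀ i x, C (inc F i x))
    (ha : ∀ x y, C x → C y → C (x + y)) (x : (coprod F).M) : C x := by
  classical
  induction x using DFinsupp.induction with
  | h0 => exact h0
  | ha i b f _ _ hf => exact ha _ _ (hi i b) hf

lemma cop_ext {N : Type} [AddCommGroup N] (f g : (coprod F).M →+ N)
    (h : ∀ i x, f (inc F i x) = g (inc F i x)) (x : (coprod F).M) : f x = g x := by
  induction x using cop_induction F with
  | h0 => simp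
  | hi i x => exact h i x
  | ha x y hx hy => rw [map_add, map_add, hx, hy]

@[simp] lemma prj_inc_same (i : ι) (x : (F i).M) : prj F i (inc F i x) = x := by
  classical
  simp [prj, inc]

lemma prj_inc_ne (i j : ι) (h : i ≠ j) (x : (F i).M) : prj F j (inc F i x) = 0 := by
  classical
  simp [prj, inc, DFinsupp.single_eq_of_ne (Ne.symm h)]

lemma inc_deg (i : ι) : Deg (F i) (coprod F) 0 (inc F i) := by
  classical
  intro k m hm j
  by_cases h : i = j
  · subst h; simpa [inc] using hm
  · simp only [inc, DFinsupp.lsingle_apply, DFinsupp.single_eq_of_ne (Ne.symm h)]; exact zero_mem _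

lemma inc_cm (i : ι) : Cm (F i) (coprod F) (inc F i) := by
  classical
  intro m
  simp [inc]

lemma prj_deg (i : ι) : Deg (coprod F) (F i) 0 (prj F i) := by
  intro k m hm
  rw [add_zero]
  exact hm i

lemma prj_cm (i : ι) : Cm (coprod F) (F i) (prj F i) := by
  intro m; rfl

lemma desc_deg (N : DGMod A 𝒜 dA) (n : ℤ) (f : ∀ i, (F i).M →ₗ[A] N.M)
    (h : ∀ i, Deg (F i) N n (f i)) : Deg (coprod F) N n (desc F N f) := by
  classical
  intro k m hm
  simp only [desc, DFinsupp.lsum_apply_apply]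
  rw [DFinsupp.sumAddHom_apply]
  exact sum_mem (fun i _ => h i k _ (hm i))

lemma desc_cm (N : DGMod A 𝒜 dA) (f : ∀ i, (F i).M →ₗ[A] N.M)
    (h : ∀ i, Cm (F i) N (f i)) : Cm (coprod F) N (desc F N f) := by
  intro m
  refine cop_ext F ((desc F N f).toAddMonoidHom.comp (coprod F).d)
    (N.d.comp (desc F N f).toAddMonoidHom) ?_ m
  intro i x
  show desc F N f ((coprod F).d (inc F i x)) = N.d (desc F N f (inc F i x))
  rw [← inc_cm, desc_inc, desc_inc, h]

end coprod

end DGX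
end

noncomputable section
namespace DGX
open DirectSum

section null
variable {M N L : DGMod A 𝒜 dA} {n k n' : ℤ}

lemma Deg.add {f g : M.M →ₗ[A] N.M} (hf : Deg M N n f) (hg : Deg M N n g) :
    Deg M N n (f + g) := fun i m hm => add_mem (hf i m hm) (hg i m hm)
lemma Deg.sub {f g : M.M →ₗ[A] N.M} (hf : Deg M N n f) (hg : Deg M N n g) :
    Deg M N n (f - g) := fun i m hm => sub_mem (hf i m hm) (hg i m hm)
lemma Deg.neg {f : M.M →ₗ[A] N.M} (hf : Deg M N n f) :
    Deg M N n (-f) := fun i m hm => neg_mem (hf i m hm)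
lemma Deg.zsmul {f : M.M →ₗ[A] N.M} (hf : Deg M N n f) (z : ℤ) :
    Deg M N n (z • f) := fun i m hm => zsmul_mem (hf i m hm) z
lemma Deg.zero : Deg M N n 0 := fun i m _ => zero_mem _
lemma Deg.id : Deg M M 0 LinearMap.id := fun i m hm => by simpa using hm
lemma Deg.comp {g : N.M →ₗ[A] L.M} {f : M.M →ₗ[A] N.M} (hg : Deg N L k g) (hf : Deg M N n f)
    (h : n' = n + k) : Deg M L n' (g ∘ₗ f) := fun i m hm => by
  have := hg _ _ (hf i m hm)
  rwa [add_assoc, ← h] at this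

lemma Cm.add {f g : M.M →ₗ[A] N.M} (hf : Cm M N f) (hg : Cm M N g) :
    Cm M N (f + g) := fun m => by simp [hf m, hg m]
lemma Cm.sub {f g : M.M →ₗ[A] N.M} (hf : Cm M N f) (hg : Cm M N g) :
    Cm M N (f - g) := fun m => by simp [hf m, hg m]
lemma Cm.neg {f : M.M →ₗ[A] N.M} (hf : Cm M N f) : Cm M N (-f) := fun m => by simp [hf m]
lemma Cm.zsmul {f : M.M →ₗ[A] N.M} (hf : Cm M N f) (z : ℤ) : Cm M N (z • f) :=
  fun m => by simp [hf m]
lemma Cm.zero : Cm M N 0 := fun m => by simp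
lemma Cm.id : Cm M M LinearMap.id := fun m => rfl
lemma Cm.comp {g : N.M →ₗ[A] L.M} {f : M.M →ₗ[A] N.M} (hg : Cm N L g) (hf : Cm M N f) :
    Cm M L (g ∘ₗ f) := fun m => by simp [hf m, hg _]

lemma Null.add {f g : M.M →ₗ[A] N.M} (hf : Null M N n f) (hg : Null M N n g) :
    Null M N n (f + g) := by
  obtain ⟨h, hd, he⟩ := hf
  obtain ⟨h', hd', he'⟩ := hg
  refine ⟨h + h', hd.add hd', fun m => ?_⟩
  simp only [LinearMap.add_apply, he, he', map_add]; abel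

lemma Null.zsmul {f : M.M →ₗ[A] N.M} (hf : Null M N n f) (z : ℤ) :
    Null M N n (z • f) := by
  obtain ⟨h, hd, he⟩ := hf
  refine ⟨z • h, hd.zsmul z, fun m => ?_⟩
  simp only [LinearMap.smul_apply, he, map_zsmul, smul_sub]

lemma Null.neg {f : M.M →ₗ[A] N.M} (hf : Null M N n f) : Null M N n (-f) := by
  simpa using hf.zsmul (-1)

lemma Null.sub {f g : M.M →ₗ[A] N.M} (hf : Null M N n f) (hg : Null M N n g) :
    Null M N n (f - g) := by
  rw [sub_eq_add_neg]; exact hf.add hg.neg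

lemma Null.zero : Null M N n 0 := ⟨0, Deg.zero, by simp⟩

lemma Null.comp_left {g : N.M →ₗ[A] L.M} {f : M.M →ₗ[A] N.M} (hf : Null M N n f)
    (hg : Deg N L k g) (hc : Cm N L g) (hn : n' = n + k) : Null M L n' (g ∘ₗ f) := by
  obtain ⟨h, hd, he⟩ := hf
  refine ⟨g ∘ₗ h, hg.comp hd (by omega), fun m => ?_⟩
  simp [he, hc _]

lemma Null.comp_right {g : N.M →ₗ[A] L.M} {f : M.M →ₗ[A] N.M} (hg : Null N L k g)
    (hf : Deg M N n f) (hc : Cm M N f) (hn : n' = n + k) : Null M L n' (g ∘ₗ f) := by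
  obtain ⟨h, hd, he⟩ := hg
  refine ⟨sgn n • (h ∘ₗ f), (hd.comp hf (by omega)).zsmul _, fun m => ?_⟩
  have h1 : f (ε M m) = sgn n • ε N (f m) := by
    rw [ε_f hf, smul_smul, sgn_mul_self, one_smul]
  simp [h1, he, hc _, smul_sub]

end null

/-- test classes -/
def Tst (N : DGMod A 𝒜 dA) (G : Set (N.M →ₗ[A] N.M)) (C : DGMod A 𝒜 dA) : Prop :=
  ∀ n f, Deg C N n f → Cm C N f → ∃ g ∈ G, Null C N n (g ∘ₗ f)

/-- admissible sets of endomorphisms -/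
structure Adm (N : DGMod A 𝒜 dA) (G : Set (N.M →ₗ[A] N.M)) : Prop where
  deg : ∀ g ∈ G, Deg N N 0 g
  cm : ∀ g ∈ G, Cm N N g
  comp : ∀ g ∈ G, ∀ g' ∈ G, g ∘ₗ g' ∈ G

lemma Tst.shift {N : DGMod A 𝒜 dA} {G : Set (N.M →ₗ[A] N.M)} {C : DGMod A 𝒜 dA}
    (h : Tst N G C) (k : ℤ) : Tst N G (shift C k) := by
  intro n f hf hc
  have hf' : Deg C N (n + k) f := by
    intro i m hm
    have := hf (i + k) m (by simpa using hm)
    rwa [add_assoc, add_comm k] at this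
  obtain ⟨g, hg, l, hl, he⟩ := h (n + k) f hf' hc
  refine ⟨g, hg, sgn k • l, ?_, ?_⟩
  · intro i m hm
    refine zsmul_mem ?_ _
    have := hl (i - k) m hm
    rwa [show i - k + (n + k + 1) = i + (n + 1) by ring] at this
  · intro m
    rw [ε_shift, map_zsmul, he, smul_sub, LinearMap.smul_apply, LinearMap.smul_apply, map_zsmul]

lemma inl_cm (M N : DGMod A 𝒜 dA) (τ : M.M →ₗ[A] N.M) (hd : Deg M N (-1) τ)
    (hc : Cm M N τ) : Cm N (ext M N τ hd hc) (LinearMap.inl A N.M M.M) := by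
  intro m
  simp [ext_d]

lemma inl_deg (M N : DGMod A 𝒜 dA) (τ : M.M →ₗ[A] N.M) (hd : Deg M N (-1) τ)
    (hc : Cm M N τ) : Deg N (ext M N τ hd hc) 0 (LinearMap.inl A N.M M.M) := by
  intro i m hm
  rw [add_zero]
  exact ⟨hm, zero_mem _⟩

lemma snd_cm (M N : DGMod A 𝒜 dA) (τ : M.M →ₗ[A] N.M) (hd : Deg M N (-1) τ)
    (hc : Cm M N τ) : Cm (ext M N τ hd hc) M (LinearMap.snd A N.M M.M) := by
  rintro ⟨x, y⟩
  rfl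

lemma snd_deg (M N : DGMod A 𝒜 dA) (τ : M.M →ₗ[A] N.M) (hd : Deg M N (-1) τ)
    (hc : Cm M N τ) : Deg (ext M N τ hd hc) M 0 (LinearMap.snd A N.M M.M) := by
  rintro i ⟨x, y⟩ h
  rw [add_zero]
  exact h.2

lemma inr_deg (M N : DGMod A 𝒜 dA) (τ : M.M →ₗ[A] N.M) (hd : Deg M N (-1) τ)
    (hc : Cm M N τ) : Deg M (ext M N τ hd hc) 0 (LinearMap.inr A N.M M.M) := by
  intro i m hm
  rw [add_zero]
  exact ⟨zero_mem _, hm⟩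

lemma fst_deg (M N : DGMod A 𝒜 dA) (τ : M.M →ₗ[A] N.M) (hd : Deg M N (-1) τ)
    (hc : Cm M N τ) : Deg (ext M N τ hd hc) N 0 (LinearMap.fst A N.M M.M) := by
  rintro i ⟨x, y⟩ h
  rw [add_zero]
  exact h.1

lemma coprod_deg {M N L : DGMod A 𝒜 dA} {n : ℤ} {τ : M.M →ₗ[A] N.M} (hd : Deg M N (-1) τ)
    (hc : Cm M N τ) {f : N.M →ₗ[A] L.M} {g : M.M →ₗ[A] L.M} (hf : Deg N L n f)
    (hg : Deg M L n g) : Deg (ext M N τ hd hc) L n (f.coprod g) := by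
  rintro i ⟨x, y⟩ h
  exact add_mem (hf _ _ h.1) (hg _ _ h.2)

lemma prod_deg {M N L : DGMod A 𝒜 dA} {n : ℤ} {τ : M.M →ₗ[A] N.M} (hd : Deg M N (-1) τ)
    (hc : Cm M N τ) {f : L.M →ₗ[A] N.M} {g : L.M →ₗ[A] M.M} (hf : Deg L N n f)
    (hg : Deg L M n g) : Deg L (ext M N τ hd hc) n (f.prod g) := by
  rintro i x h
  exact ⟨hf _ _ h, hg _ _ h⟩

lemma ετ {M N : DGMod A 𝒜 dA} {τ : M.M →ₗ[A] N.M} (hd : Deg M N (-1) τ) (y : M.M) :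
    τ (ε M y) = - ε N (τ y) := by
  rw [ε_f hd]; simp

lemma Tst.ext {N : DGMod A 𝒜 dA} {G : Set (N.M →ₗ[A] N.M)} (hG : Adm N G) {C C' : DGMod A 𝒜 dA}
    (h : Tst N G C) (h' : Tst N G C') (τ : C.M →ₗ[A] C'.M) (hd : Deg C C' (-1) τ)
    (hc : Cm C C' τ) : Tst N G (ext C C' τ hd hc) := by
  intro n f hf hfc
  obtain ⟨g1, hg1, k, hk, ek⟩ := h' n (f ∘ₗ LinearMap.inl A _ _)
    (hf.comp (inl_deg C C' τ hd hc) (by omega)) (hfc.comp (inl_cm C C' τ hd hc))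
  have hg1d := hG.deg _ hg1
  have hg1c := hG.cm _ hg1
  let r : C.M →ₗ[A] N.M := g1 ∘ₗ f ∘ₗ LinearMap.inr A _ _ + k ∘ₗ τ
  have hr : Deg C N n r := by
    refine Deg.add (hg1d.comp (hf.comp (inr_deg C C' τ hd hc) (n' := n) (by omega)) (by omega)) ?_
    exact hk.comp hd (by omega)
  have hrc : Cm C N r := by
    intro y
    have e1 := ek (τ y)
    have e2 := hfc (0, y)
    rw [ext_d] at e2
    simp only [LinearMap.comp_apply, LinearMap.inl_apply] at e1
    have e3 : f (0, C.d y) = N.d (f (0, y)) - f (τ (ε C y), 0) := by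
      rw [← e2, ← map_sub]; simp
    have e4 : f (τ (ε C y), 0) = - f (ε C' (τ y), 0) := by
      rw [ετ hd, ← map_neg f, Prod.neg_mk, neg_zero]
    show g1 (f (0, C.d y)) + k (τ (C.d y)) = N.d (g1 (f (0, y)) + k (τ y))
    rw [e3, e4, map_sub, map_neg, e1, map_add, hg1c _, hc]
    abel
  obtain ⟨g2, hg2, l, hl, el⟩ := h n r hr hrc
  have hg2d := hG.deg _ hg2
  have hg2c := hG.cm _ hg2
  refine ⟨g2 ∘ₗ g1, hG.comp _ hg2 _ hg1, (g2 ∘ₗ k).coprod l, ?_, ?_⟩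
  · exact coprod_deg hd hc (hg2d.comp hk (by omega)) hl
  · rintro ⟨x, y⟩
    rw [ε_ext, ext_d]
    have e1 := ek x
    have e2 := el y
    simp only [LinearMap.comp_apply, LinearMap.inl_apply] at e1 e2
    have e3 : r (ε C y) = g1 (f (0, ε C y)) + k (τ (ε C y)) := rfl
    rw [e3] at e2
    have e4 : f (ε C' x, ε C y) = f (ε C' x, 0) + f (0, ε C y) := by rw [← map_add]; simp
    simp only [LinearMap.comp_apply, LinearMap.coprod_apply, e4, map_add, e1, map_sub, hg2c _]
    rw [map_add] at e2
    rw [← eq_sub_iff_add_eq] at e2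
    rw [e2]; abel

/-- homotopy retracts -/
lemma Tst.retract {N : DGMod A 𝒜 dA} {G : Set (N.M →ₗ[A] N.M)} (hG : Adm N G)
    {C C' : DGMod A 𝒜 dA} (h' : Tst N G C') (u : C.M →ₗ[A] C'.M) (v : C'.M →ₗ[A] C.M)
    (hu : Deg C C' 0 u) (huc : Cm C C' u) (hv : Deg C' C 0 v) (hvc : Cm C' C v)
    (hn : Null C C 0 (v ∘ₗ u - LinearMap.id)) : Tst N G C := by
  intro n f hf hfc
  obtain ⟨g, hg, hnull⟩ := h' n (f ∘ₗ v) (hf.comp hv (by omega)) (hfc.comp hvc)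
  refine ⟨g, hg, ?_⟩
  have h1 := hnull.comp_right hu huc (n' := n) (by omega)
  have h2 := (hn.comp_left hf hfc (n' := n) (by omega)).comp_left (hG.deg g hg) (hG.cm g hg)
    (n' := n) (by omega)
  convert h1.sub h2 using 1
  ext x; simp

/-- K-projective -/
def Kp (C : DGMod A 𝒜 dA) : Prop := ∀ N : DGMod A 𝒜 dA, Acyc N → Tst N {LinearMap.id} C

lemma adm_id (N : DGMod A 𝒜 dA) : Adm N {LinearMap.id} where
  deg := by rintro g rfl; exact Deg.id
  cm := by rintro g rfl; exact Cm.id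
  comp := by rintro g rfl g' rfl; rfl

lemma Kp.null {C N : DGMod A 𝒜 dA} (h : Kp C) (hN : Acyc N) {n : ℤ} {f : C.M →ₗ[A] N.M}
    (hf : Deg C N n f) (hc : Cm C N f) : Null C N n f := by
  obtain ⟨g, rfl, hg⟩ := h N hN n f hf hc
  simpa using hg

/-- finite part of a coproduct -/
def IFin {ι : Type} (F : ι → DGMod A 𝒜 dA) :
    AddSubgroup ((coprod F).M →ₗ[A] (coprod F).M) :=
  AddSubgroup.closure {φ | ∃ (i : ι) (c : (coprod F).M →ₗ[A] (F i).M), Deg (coprod F) (F i) 0 c ∧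
    Cm (coprod F) (F i) c ∧ φ = inc F i ∘ₗ c}

/-- endomorphisms that are the identity up to a finite part -/
def Cof {ι : Type} (F : ι → DGMod A 𝒜 dA) : Set ((coprod F).M →ₗ[A] (coprod F).M) :=
  {g | Deg (coprod F) (coprod F) 0 g ∧ Cm (coprod F) (coprod F) g ∧ LinearMap.id - g ∈ IFin F}

lemma adm_cof {ι : Type} (F : ι → DGMod A 𝒜 dA) : Adm (coprod F) (Cof F) where
  deg := fun g hg => hg.1
  cm := fun g hg => hg.2.1
  comp := by
    intro g hg g' hg'
    refine ⟨hg.1.comp hg'.1 (by omega), hg.2.1.comp hg'.2.1, ?_⟩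
    have h1 : ∀ φ ∈ IFin F, φ ∘ₗ g' ∈ IFin F := by
      intro φ hφ
      induction hφ using AddSubgroup.closure_induction with
      | mem φ hφ =>
        obtain ⟨i, c, hc, hcc, rfl⟩ := hφ
        exact AddSubgroup.subset_closure ⟨i, c ∘ₗ g', hc.comp hg'.1 (by omega),
          hcc.comp hg'.2.1, rfl⟩
      | zero => simp
      | add x y _ _ hx hy => rw [LinearMap.add_comp]; exact add_mem hx hy
      | neg x _ hx => rw [LinearMap.neg_comp]; exact neg_mem hx
    have h2 := add_mem hg'.2.2 (h1 _ hg.2.2)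
    convert h2 using 1
    ext x; simp

/-- homotopically compact -/
def Cpt (C : DGMod A 𝒜 dA) : Prop :=
  ∀ (ι : Type) (F : ι → DGMod A 𝒜 dA), Tst (coprod F) (Cof F) C

/-- generators -/
structure IsGen (Z : DGMod A 𝒜 dA) (u : Z.M) : Prop where
  mem : u ∈ Z.ℳ 0
  du : Z.d u = 0
  surj : ∀ z, ∃ a : A, a • u = z

lemma dA_one (hA : IsDGAlgebra A 𝒜 dA) : dA 1 = 0 := by
  have := hA.leibniz 1 1 hA.one_mem
  simpa using this

/-- the unit of `A` as an element of the dg module `A` -/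
def oneA (hA : IsDGAlgebra A 𝒜 dA) : (aMod hA).M := (1 : A)

lemma gen_one (hA : IsDGAlgebra A 𝒜 dA) : IsGen (aMod hA) (oneA hA) where
  mem := hA.one_mem
  du := @dA_one A _ 𝒜 dA hA
  surj := fun z => ⟨z, @mul_one A _ z⟩

/-- `N` is a module over the quotient of `A` by the annihilator of `u` -/
def Fr (Z : DGMod A 𝒜 dA) (u : Z.M) (N : DGMod A 𝒜 dA) : Prop :=
  ∀ x : N.M, ∃ ψ : Z.M →ₗ[A] N.M, ψ u = x

lemma fr_one (hA : IsDGAlgebra A 𝒜 dA) (N : DGMod A 𝒜 dA) : Fr (aMod hA) (oneA hA) N := by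
  intro x
  exact ⟨LinearMap.toSpanSingleton A N.M x, LinearMap.toSpanSingleton_apply_one A N.M x⟩

lemma IsGen.p_smul {Z : DGMod A 𝒜 dA} {u : Z.M} (hA : IsDGAlgebra A 𝒜 dA) (h : IsGen Z u)
    (i : ℤ) (a : A) : p Z i (a • u) = (gp hA.internal i a) • u := by
  refine gr_ext hA.internal ((p Z i).comp ((AddMonoidHom.flip (smulAddHom A Z.M)) u))
    (((AddMonoidHom.flip (smulAddHom A Z.M)) u).comp (gp hA.internal i)) ?_ a
  intro j a ha
  have hm : a • u ∈ Z.ℳ j := by simpa using Z.smul_mem ha h.mem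
  by_cases hij : j = i
  · subst hij
    simp [p, gp_same _ ha, gp_same _ hm]
  · simp [p, gp_ne _ ha hij, gp_ne _ hm hij]

lemma IsGen.deg {Z N : DGMod A 𝒜 dA} {u : Z.M} (hA : IsDGAlgebra A 𝒜 dA) (h : IsGen Z u)
    {n : ℤ} {ψ : Z.M →ₗ[A] N.M} (hψ : ψ u ∈ N.ℳ n) : Deg Z N n ψ := by
  intro i m hm
  obtain ⟨a, rfl⟩ := h.surj m
  have := h.p_smul hA i a
  rw [p, gp_same _ hm] at this
  rw [this, map_smul]
  exact N.smul_mem (gp_mem _ _ _) hψ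

lemma IsGen.htpy {Z N : DGMod A 𝒜 dA} {u : Z.M} (hA : IsDGAlgebra A 𝒜 dA) (h : IsGen Z u)
    {ψ f : Z.M →ₗ[A] N.M} (hψ : f u = N.d (ψ u)) (m : Z.M) :
    f (ε Z m) = N.d (ψ m) - ψ (Z.d m) := by
  obtain ⟨a, rfl⟩ := h.surj m
  induction a using gr_induction hA.internal with
  | hh i a ha =>
    rw [ε_smul Z a ha, ε_mem Z h.mem, leib Z a u ha, h.du]
    simp only [sgn_zero, one_smul, map_zsmul, map_smul, hψ, leib N a _ ha, smul_zero, add_zero]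
    abel
  | ha x y hx hy =>
    simp only [add_smul, map_add, hx, hy]; abel

lemma IsGen.cm {Z N : DGMod A 𝒜 dA} {u : Z.M} (hA : IsDGAlgebra A 𝒜 dA) (h : IsGen Z u)
    {ψ : Z.M →ₗ[A] N.M} (hψ : N.d (ψ u) = 0) : Cm Z N ψ := by
  intro m
  have := h.htpy hA (ψ := ψ) (f := 0) (by simp [hψ]) m
  exact (sub_eq_zero.mp (by simpa using this.symm)).symm

lemma tst_A (hA : IsDGAlgebra A 𝒜 dA) (N : DGMod A 𝒜 dA) (G : Set (N.M →ₗ[A] N.M))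
    (h : ∀ n x, x ∈ N.ℳ n → N.d x = 0 → ∃ g ∈ G, ∃ w ∈ N.ℳ (n + 1), N.d w = g x) :
    Tst N G (aMod hA) := by
  intro n f hf hc
  have hx : f (oneA hA) ∈ N.ℳ n := by simpa using hf 0 (oneA hA) (gen_one hA).mem
  have hdx : N.d (f (oneA hA)) = 0 := by
    rw [← hc, (gen_one hA).du, map_zero]
  obtain ⟨g, hg, w, hw, he⟩ := h n _ hx hdx
  obtain ⟨ψ, hψ⟩ := fr_one hA N w
  refine ⟨g, hg, ψ, ?_, ?_⟩
  · exact (gen_one hA).deg hA (by rw [hψ]; exact hw)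
  · refine (gen_one hA).htpy hA ?_
    rw [hψ, he]; rfl

lemma Acyc.hom {N : DGMod A 𝒜 dA} (h : Acyc N) {n : ℤ} {x : N.M} (hx : x ∈ N.ℳ n)
    (hd : N.d x = 0) : ∃ w ∈ N.ℳ (n + 1), N.d w = x := by
  obtain ⟨w, hw⟩ := h x hd
  refine ⟨p N (n + 1) w, gp_mem _ _ _, ?_⟩
  rw [← p_d, hw, p, gp_same _ hx]

lemma kp_A (hA : IsDGAlgebra A 𝒜 dA) : Kp (aMod hA) := by
  intro N hN
  refine tst_A hA N _ ?_
  intro n x hx hd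
  exact ⟨_, rfl, hN.hom hx hd⟩

lemma cpt_A (hA : IsDGAlgebra A 𝒜 dA) : Cpt (aMod hA) := by
  classical
  intro ι F
  refine tst_A hA _ _ ?_
  intro n x hx hd
  have key : ∀ x : (coprod F).M, ∃ φ ∈ IFin F, Deg (coprod F) (coprod F) 0 φ ∧
      Cm (coprod F) (coprod F) φ ∧ φ x = x := by
    intro x
    let φ : (coprod F).M →ₗ[A] (coprod F).M :=
      ∑ i ∈ DFinsupp.support (β := fun i => (F i).M) x, inc F i ∘ₗ prj F i
    refine ⟨φ, ?_, ?_, ?_, ?_⟩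
    · exact sum_mem (fun i _ => AddSubgroup.subset_closure
        ⟨i, prj F i, prj_deg F i, prj_cm F i, rfl⟩)
    · exact Finset.sum_induction _ (fun φ => Deg (coprod F) (coprod F) 0 φ)
        (fun _ _ h h' => h.add h') Deg.zero
        (fun i _ => (inc_deg F i).comp (prj_deg F i) (by omega))
    · exact Finset.sum_induction _ (fun φ => Cm (coprod F) (coprod F) φ)
        (fun _ _ h h' => h.add h') Cm.zero
        (fun i _ => (inc_cm F i).comp (prj_cm F i))
    · simp only [φ, LinearMap.sum_apply, LinearMap.comp_apply]
      exact DFinsupp.sum_single (β := fun i => (F i).M) (f := x)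
  obtain ⟨φ, h1, h2, h3, h4⟩ := key x
  refine ⟨LinearMap.id - φ, ⟨Deg.id.sub h2, Cm.id.sub h3, by simpa using h1⟩, 0, zero_mem _, ?_⟩
  simp [h4]

end DGX
end

noncomputable section
namespace DGX
open DirectSum

section qis
variable {M N L : DGMod A 𝒜 dA}

lemma Null.cycle {n : ℤ} {f : M.M →ₗ[A] N.M} (h : Null M N n f) {z : M.M} (hz : M.d z = 0) :
    ∃ w, f z = N.d w := by
  obtain ⟨l, -, e⟩ := h
  refine ⟨l (ε M z), ?_⟩
  have := e (ε M z)
  have h2 : M.d (ε M z) = 0 := by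
    have := ε_d M z
    rw [hz, map_zero] at this
    simpa using this.symm
  rw [ε_ε, h2] at this
  simpa using this

lemma Qis.of_null {f g : M.M →ₗ[A] N.M} (hf : Qis M N f) {n : ℤ} (h : Null M N n (f - g)) :
    Qis M N g := by
  constructor
  · intro z hz
    obtain ⟨z', w, h1, h2⟩ := hf.1 z hz
    obtain ⟨w', hw'⟩ := h.cycle h1
    refine ⟨z', w - w', h1, ?_⟩
    rw [LinearMap.sub_apply, h2] at hw'
    rw [map_sub, ← hw']; abel
  · rintro z hz ⟨w, hw⟩
    obtain ⟨w', hw'⟩ := h.cycle hz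
    refine hf.2 z hz ⟨w + w', ?_⟩
    rw [map_add, ← hw, ← hw']; simp

lemma Qis.comp {g : N.M →ₗ[A] L.M} {f : M.M →ₗ[A] N.M} (hg : Qis N L g) (hf : Qis M N f)
    (hgc : Cm N L g) (hfc : Cm M N f) : Qis M L (g ∘ₗ f) := by
  constructor
  · intro z hz
    obtain ⟨z', w, h1, h2⟩ := hg.1 z hz
    obtain ⟨z'', w', h1', h2'⟩ := hf.1 z' h1
    refine ⟨z'', w + g w', h1', ?_⟩
    simp [h2', h2, hgc _, add_assoc]
  · rintro z hz ⟨w, hw⟩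
    exact hf.2 z hz (hg.2 (f z) (by rw [← hfc, hz, map_zero]) ⟨w, hw⟩)

lemma Qis.of_comp {g : N.M →ₗ[A] L.M} {f : M.M →ₗ[A] N.M} (hg : Qis N L g)
    (hgf : Qis M L (g ∘ₗ f)) (hgc : Cm N L g) (hfc : Cm M N f) : Qis M N f := by
  constructor
  · intro z hz
    obtain ⟨z', w, h1, h2⟩ := hgf.1 (g z) (by rw [← hgc, hz, map_zero])
    obtain ⟨v, hv⟩ := hg.2 (f z' - z) (by rw [map_sub, ← hfc, h1, hz]; simp)
      ⟨w, by rw [map_sub, ← LinearMap.comp_apply, h2]; simp⟩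
    exact ⟨z', v, h1, by rw [← hv]; abel⟩
  · rintro z hz ⟨w, hw⟩
    exact hgf.2 z hz ⟨g w, by simp [hw, hgc _]⟩

lemma Qis.of_bij {f : M.M →ₗ[A] N.M} (hf : Function.Bijective f) (hfc : Cm M N f) :
    Qis M N f := by
  constructor
  · intro z hz
    obtain ⟨z', rfl⟩ := hf.2 z
    refine ⟨z', 0, hf.1 ?_, by simp⟩
    rw [hfc, hz, map_zero]
  · rintro z hz ⟨w, hw⟩
    obtain ⟨v, rfl⟩ := hf.2 w
    exact ⟨v, hf.1 (by rw [hw, hfc])⟩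

lemma deg_cone {q : M.M →ₗ[A] N.M} (h : Deg M N 0 q) : Deg (shift M 1) N (-1) q := by
  intro i m hm
  have := h _ _ hm
  rwa [add_zero] at this

lemma ε_shift_one (M : DGMod A 𝒜 dA) (m : M.M) : ε (shift M 1) m = - ε M m := by
  rw [ε_shift]; simp

/-- mapping cone -/
@[reducible] def cone (q : M.M →ₗ[A] N.M) (h : Deg M N 0 q) (hc : Cm M N q) : DGMod A 𝒜 dA :=
  ext (shift M 1) N q (deg_cone h) hc

lemma ε_cyc (M : DGMod A 𝒜 dA) (m : M.M) : M.d (ε M m) = - ε M (M.d m) := by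
  rw [ε_d, neg_neg]

lemma cone_acyc (q : M.M →ₗ[A] N.M) (h : Deg M N 0 q) (hc : Cm M N q) (hq : Qis M N q) :
    Acyc (cone q h hc) := by
  rintro ⟨y, x⟩ hz
  rw [ext_d] at hz
  have h1 : N.d y + q (ε (shift M 1) x) = 0 := congrArg Prod.fst hz
  have h2 : M.d x = 0 := congrArg Prod.snd hz
  have h4 := ε_cyc (shift M 1) x
  obtain ⟨v, hv⟩ := hq.2 (ε (shift M 1) x)
    (by
      have : (shift M 1).d x = 0 := h2
      rw [this, map_zero, neg_zero] at h4; exact h4)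
    ⟨-y, by rw [map_neg]; exact (eq_neg_of_add_eq_zero_right h1)⟩
  rw [hv, hc, ← map_add] at h1
  obtain ⟨z', w, h5, h6⟩ := hq.1 _ h1
  refine ⟨(-w, ε (shift M 1) (z' - v)), ?_⟩
  rw [ext_d, ε_ε, ε_cyc]
  refine Prod.ext ?_ ?_
  · simp only [map_neg, map_sub, h6]; abel
  · show - ε (shift M 1) (M.d (z' - v)) = x
    rw [map_sub, h5, ← hv, zero_sub, map_neg, neg_neg, ε_ε]

lemma Kp.shift {C : DGMod A 𝒜 dA} (h : Kp C) (n : ℤ) : Kp (shift C n) :=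
  fun N hN => (h N hN).shift n

lemma Kp.ext {C C' : DGMod A 𝒜 dA} (h : Kp C) (h' : Kp C') (τ : C.M →ₗ[A] C'.M)
    (hd : Deg C C' (-1) τ) (hc : Cm C C' τ) : Kp (ext C C' τ hd hc) :=
  fun N hN => Tst.ext (adm_id N) (h N hN) (h' N hN) τ hd hc

lemma ε_inc {ι : Type} (F : ι → DGMod A 𝒜 dA) (i : ι) (x : (F i).M) :
    ε (coprod F) (inc F i x) = inc F i (ε (F i) x) := ε_f0 (inc_deg F i) x

lemma Kp.coprod {ι : Type} {F : ι → DGMod A 𝒜 dA} (h : ∀ i, Kp (F i)) : Kp (coprod F) := by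
  intro N hN n f hf hc
  refine ⟨_, rfl, ?_⟩
  have := fun i => (h i).null hN (hf.comp (inc_deg F i) (n' := n) (by omega))
    (hc.comp (inc_cm F i))
  choose l hl el using this
  refine ⟨desc F N l, desc_deg F N _ l hl, fun m => ?_⟩
  refine cop_ext F (f.toAddMonoidHom.comp (ε (DGX.coprod F)))
    (N.d.comp (desc F N l).toAddMonoidHom - (desc F N l).toAddMonoidHom.comp (DGX.coprod F).d) ?_ m
  intro i x
  have := el i x
  show f (ε (DGX.coprod F) (inc F i x)) =
    N.d (desc F N l (inc F i x)) - desc F N l ((DGX.coprod F).d (inc F i x))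
  rw [← inc_cm, desc_inc, desc_inc, ← this, ε_inc]; rfl

lemma Kp.lift {C : DGMod A 𝒜 dA} (h : Kp C) {q : M.M →ₗ[A] N.M} (hd : Deg M N 0 q)
    (hc : Cm M N q) (hq : Qis M N q) {n : ℤ} {f : C.M →ₗ[A] N.M} (hf : Deg C N n f)
    (hfc : Cm C N f) :
    ∃ f' : C.M →ₗ[A] M.M, Deg C M n f' ∧ Cm C M f' ∧ Null C N n (f - q ∘ₗ f') := by
  have hi1 := inl_deg (DGX.shift M 1) N q (deg_cone hd) hc
  have hi2 := inl_cm (DGX.shift M 1) N q (deg_cone hd) hc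
  obtain ⟨l, hl, el⟩ := h.null (n := n) (f := LinearMap.inl A N.M M.M ∘ₗ f)
    (cone_acyc q hd hc hq) (hi1.comp hf (n' := n) (by omega)) (hi2.comp hfc)
  let l1 : C.M →ₗ[A] N.M := LinearMap.fst A N.M M.M ∘ₗ l
  let l2 : C.M →ₗ[A] M.M := LinearMap.snd A N.M M.M ∘ₗ l
  have hl2 : Deg C M n l2 := by
    intro i m hm
    have : l2 m ∈ M.ℳ (i + (n + 1) - 1) := (hl i m hm).2
    rwa [show i + (n + 1) - 1 = i + n by ring] at this
  have e : ∀ m, f (ε C m) = N.d (l1 m) + q (ε (DGX.shift M 1) (l2 m)) - l1 (C.d m) ∧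
      0 = M.d (l2 m) - l2 (C.d m) := by
    intro m
    have := el m
    exact ⟨congrArg Prod.fst this, congrArg Prod.snd this⟩
  refine ⟨-((sgn n) • l2), (hl2.zsmul _).neg, (Cm.zsmul (fun m => ?_) _).neg, l1, ?_, ?_⟩
  · exact (sub_eq_zero.mp (e m).2.symm).symm
  · intro i m hm
    exact (hl i m hm).1
  · intro m
    have h1 := (e m).1
    rw [ε_shift_one, ε_f hl2] at h1
    simp only [LinearMap.sub_apply, h1, LinearMap.comp_apply, LinearMap.smul_apply, map_neg,
      map_zsmul, LinearMap.neg_apply]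
    abel

lemma Kp.inj {C : DGMod A 𝒜 dA} (h : Kp C) {q : M.M →ₗ[A] N.M} (hd : Deg M N 0 q)
    (hc : Cm M N q) (hq : Qis M N q) {n : ℤ} {f : C.M →ₗ[A] M.M} (hf : Deg C M n f)
    (hfc : Cm C M f) (hn : Null C N n (q ∘ₗ f)) : Null C M n f := by
  obtain ⟨l, hl, el⟩ := hn
  let F : C.M →ₗ[A] N.M × M.M := l.prod (sgn n • f)
  have hF : Deg C (cone q hd hc) (n + 1) F := by
    intro i m hm
    refine ⟨hl i m hm, ?_⟩
    have := zsmul_mem (hf i m hm) (sgn n)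
    show sgn n • f m ∈ M.ℳ (i + (n + 1) - 1)
    rwa [show i + (n + 1) - 1 = i + n by ring]
  have hFc : Cm C (cone q hd hc) F := by
    intro m
    show (l (C.d m), sgn n • f (C.d m)) = (cone q hd hc).d (l m, sgn n • f m)
    show _ = (N.d (l m) + q (ε (DGX.shift M 1) (sgn n • f m)), M.d (sgn n • f m))
    refine Prod.ext ?_ ?_
    · have := el m
      simp only [LinearMap.comp_apply] at this
      rw [ε_shift_one, map_zsmul, ε_f hf, smul_smul, sgn_mul_self, one_smul, map_neg, this]
      simp
    · simp [hfc m]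
  obtain ⟨k, hk, ek⟩ := h.null (cone_acyc q hd hc hq) hF hFc
  have hk2 : Deg C M (n + 1) (LinearMap.snd A N.M M.M ∘ₗ k) := by
    intro i m hm
    have : (k m).2 ∈ M.ℳ (i + (n + 1 + 1) - 1) := (hk i m hm).2
    show (k m).2 ∈ _
    rwa [show i + (n + 1 + 1) - 1 = i + (n + 1) by ring] at this
  have : Null C M n (sgn n • f) := ⟨_, hk2, fun m => congrArg Prod.snd (ek m)⟩
  have h2 := this.zsmul (sgn n)
  rwa [smul_smul, sgn_mul_self, one_smul] at h2

end qis

/-- closure properties -/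
structure Cl (P : DGMod A 𝒜 dA → Prop) : Prop where
  qis : ∀ {M N : DGMod A 𝒜 dA} (f : M.M →ₗ[A] N.M), Deg M N 0 f → Cm M N f → Qis M N f →
    (P M ↔ P N)
  shift : ∀ {M : DGMod A 𝒜 dA} (n : ℤ), P M → P (shift M n)
  ext : ∀ {M N : DGMod A 𝒜 dA} (τ : M.M →ₗ[A] N.M) (hd : Deg M N (-1) τ) (hc : Cm M N τ),
    P M → P N → P (ext M N τ hd hc)
  retract : ∀ {N X : DGMod A 𝒜 dA}, IsHtpyRetract N X → P X → P N

lemma shift_shift_qis (M : DGMod A 𝒜 dA) (a b c : ℤ) (h : c = a + b) :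
    Deg (shift (shift M a) b) (shift M c) 0 LinearMap.id ∧
    Cm (shift (shift M a) b) (shift M c) LinearMap.id ∧
    Qis (shift (shift M a) b) (shift M c) LinearMap.id := by
  refine ⟨?_, fun m => rfl, Qis.of_bij Function.bijective_id (fun m => rfl)⟩
  intro i m hm
  have : m ∈ M.ℳ (i - b - a) := hm
  show m ∈ M.ℳ (i + 0 - c)
  rwa [show i + 0 - c = i - b - a by omega]

lemma shift_zero_qis (M : DGMod A 𝒜 dA) :
    Deg (shift M 0) M 0 LinearMap.id ∧
    Cm (shift M 0) M LinearMap.id ∧ Qis (shift M 0) M LinearMap.id := by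
  refine ⟨?_, fun m => rfl, Qis.of_bij Function.bijective_id (fun m => rfl)⟩
  intro i m hm
  have : m ∈ M.ℳ (i - 0) := hm
  show m ∈ M.ℳ (i + 0)
  rwa [show i + 0 = i - 0 by omega]

lemma isSusp_shift (M : DGMod A 𝒜 dA) : IsSuspension M (shift M 1) := by
  refine ⟨{ toFun := ε M, invFun := ε M, left_inv := ε_ε M, right_inv := ε_ε M,
            map_add' := map_add _ }, ?_, ?_, ?_⟩
  · intro i
    ext x
    show (∃ y, y ∈ M.ℳ i ∧ ε M y = x) ↔ x ∈ M.ℳ (i + 1 - 1)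
    rw [add_sub_cancel_right]
    constructor
    · rintro ⟨y, hy, rfl⟩; exact ε_mem_iff M hy
    · intro hx; exact ⟨ε M x, ε_mem_iff M hx, ε_ε M x⟩
  · intro m; exact ε_d M m
  · intro i a m ha; exact ε_smul M a ha m

lemma IsQuasiIso.mk' {M N : DGMod A 𝒜 dA} {f : M.M →ₗ[A] N.M} (h : Deg M N 0 f) (hc : Cm M N f)
    (hq : Qis M N f) : IsQuasiIso (bun f h hc) := (qis_iff _).2 hq

lemma cl_of_thick {P : DGMod A 𝒜 dA → Prop} (h : IsThickClass P) : Cl P where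
  qis f hf hc hq := h.qis (bun f hf hc) (IsQuasiIso.mk' hf hc hq)
  shift := by
    have q : ∀ {M N : DGMod A 𝒜 dA} (f : M.M →ₗ[A] N.M), Deg M N 0 f ∧ Cm M N f ∧ Qis M N f →
      (P M ↔ P N) := fun f hf => h.qis (bun f hf.1 hf.2.1) (IsQuasiIso.mk' hf.1 hf.2.1 hf.2.2)
    intro M n hM
    induction n using Int.induction_on with
    | zero => exact (q _ (shift_zero_qis M)).2 hM
    | succ n ih =>
      exact (q _ (shift_shift_qis M n 1 _ rfl)).1 ((h.susp (isSusp_shift _)).1 ih)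
    | pred n ih =>
      refine (h.susp (isSusp_shift _)).2 ((q _ (shift_shift_qis M (-n - 1) 1 (-n) (by omega))).2 ih)
  ext := by
    intro M N τ hd hc hM hN
    refine h.ext₂ (bun _ (inl_deg M N τ hd hc) (inl_cm M N τ hd hc))
      (bun _ (snd_deg M N τ hd hc) (snd_cm M N τ hd hc)) ⟨?_, ?_, ?_⟩ hN hM
    · exact LinearMap.inl_injective
    · exact LinearMap.snd_surjective
    · rintro ⟨x, y⟩
      constructor
      · intro hy
        have hy : y = 0 := hy
        exact ⟨x, by rw [hy]; rfl⟩
      · rintro ⟨x', h'⟩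
        exact (congrArg Prod.snd h').symm
  retract := h.retract

lemma thick_of_cl (hA : IsDGAlgebra A 𝒜 dA) {P : DGMod A 𝒜 dA → Prop} (h : Cl P) :
    IsThickClass P := by
  have hcone : ∀ {M₁ M₂ M₃ : DGMod A 𝒜 dA} (f : DGHom M₁ M₂) (g : DGHom M₂ M₃),
    IsShortExactSeq f g → (P (cone (M := M₁) (N := M₂) f.toFun (deg_of _ _ f) f.comm) ↔ P M₃) := by
    intro M₁ M₂ M₃ f g ⟨hi, hs, hex⟩
    have fe : ∀ x, f.toFun (ε M₁ x) = ε M₂ (f.toFun x) := fun x => (ε_f0 (deg_of _ _ f) x).symm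
    have gf : ∀ x, g.toFun (f.toFun x) = 0 := fun x => (hex _).2 ⟨x, rfl⟩
    refine h.qis (g.toFun ∘ₗ LinearMap.fst A M₂.M M₁.M) ?_ ?_ ⟨?_, ?_⟩
    · exact (deg_of _ _ g).comp (fst_deg _ _ _ _ _) (by omega)
    · rintro ⟨y, x⟩
      show g.toFun (M₂.d y + f.toFun (ε (shift M₁ 1) x)) = M₃.d (g.toFun y)
      rw [map_add, gf, g.comm, add_zero]
    · intro z hz
      obtain ⟨y, rfl⟩ := hs z
      rw [← g.comm] at hz
      obtain ⟨x, hx⟩ := (hex _).1 hz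
      have hdx : M₁.d x = 0 := hi (by rw [f.comm, hx, M₂.d_sq, map_zero])
      refine ⟨(y, - ε (shift M₁ 1) x), 0, ?_, by simp⟩
      rw [ext_d]
      refine Prod.ext ?_ ?_
      · rw [map_neg, ε_ε, map_neg, hx]; simp
      · show (shift M₁ 1).d (- ε (shift M₁ 1) x) = 0
        rw [map_neg, ε_cyc]
        have : (shift M₁ 1).d x = 0 := hdx
        rw [this]; simp
    · rintro ⟨y, x⟩ hz ⟨w, hw⟩
      rw [ext_d] at hz
      have h1 : M₂.d y + f.toFun (ε (shift M₁ 1) x) = 0 := congrArg Prod.fst hz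
      have h2 : M₁.d x = 0 := congrArg Prod.snd hz
      obtain ⟨w, rfl⟩ := hs w
      have hw : g.toFun y = M₃.d (g.toFun w) := hw
      obtain ⟨v, hv⟩ := (hex (y - M₂.d w)).1 (by rw [map_sub, hw, g.comm, sub_self])
      have hdv : M₁.d v = - ε (shift M₁ 1) x := hi (by
        rw [f.comm, hv, map_sub, M₂.d_sq, sub_zero, map_neg]
        exact eq_neg_of_add_eq_zero_left h1)
      refine ⟨(w, ε (shift M₁ 1) v), ?_⟩
      rw [ext_d, ε_ε, ε_cyc]
      refine Prod.ext ?_ ?_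
      · rw [hv]; simp
      · show x = - ε (shift M₁ 1) (M₁.d v)
        rw [hdv, map_neg, ε_ε, neg_neg]
  refine ⟨fun f hf => h.qis _ (deg_of _ _ f) f.comm ((qis_iff f).1 hf), ?_, ?_, ?_, ?_, h.retract⟩
  · intro M N ⟨e, he1, he2, he3⟩
    let ψ : M.M →ₗ[A] N.M :=
      { toFun := fun m => e (ε M m)
        map_add' := by simp
        map_smul' := by
          intro a m
          induction a using gr_induction hA.internal with
          | hh i a ha =>
            have := he3 a (ε M m) ha
            rw [ε_smul M a ha, map_zsmul, this]
            show sgn i • sgn i • a • e (ε M m) = _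
            rw [smul_smul, sgn_mul_self, one_smul]; rfl
          | ha x y hx hy => 
            simp only [RingHom.id_apply] at hx hy ⊢
            rw [add_smul, map_add, map_add, hx, hy, add_smul] }
    have hbij : Function.Bijective ψ := by
      refine e.bijective.comp ?_
      exact ⟨fun x y hxy => by rw [← ε_ε M x, ← ε_ε M y, hxy], fun x => ⟨ε M x, ε_ε M x⟩⟩
    have hψc : Cm (shift M 1) N ψ := by
      intro m
      show e (ε M (M.d m)) = N.d (e (ε M m))
      rw [ε_d, map_neg, he2, neg_neg]
    have hψd : Deg (shift M 1) N 0 ψ := by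
      intro i m hm
      have hm : m ∈ M.ℳ (i - 1) := hm
      have := he1 (i - 1)
      rw [show i + 0 = i - 1 + 1 by ring, ← this]
      exact ⟨ε M m, ε_mem_iff M hm, rfl⟩
    rw [← h.qis (M := shift M 1) (N := N) ψ hψd hψc (Qis.of_bij hbij hψc)]
    constructor
    · exact h.shift 1
    · intro hs
      have h1 := h.shift (-1) hs
      have q := shift_shift_qis M 1 (-1) 0 (by omega)
      have h2 := (h.qis (M := shift (shift M 1) (-1)) (N := shift M 0) _ q.1 q.2.1 q.2.2).1 h1
      have q' := shift_zero_qis M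
      exact (h.qis (M := shift M 0) (N := M) _ q'.1 q'.2.1 q'.2.2).1 h2
  · intro M₁ M₂ M₃ f g ⟨hi, hs, hex⟩ h2 h3
    have gf : ∀ x, g.toFun (f.toFun x) = 0 := fun x => (hex _).2 ⟨x, rfl⟩
    have fe : ∀ x, f.toFun (ε M₁ x) = ε M₂ (f.toFun x) := fun x => (ε_f0 (deg_of _ _ f) x).symm
    have ge : ∀ x, g.toFun (ε M₂ x) = ε M₃ (g.toFun x) := fun x => (ε_f0 (deg_of _ _ g) x).symm
    have hgd : Deg M₂ (shift M₃ (-1)) (-1) g.toFun := by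
      intro i m hm
      show g.toFun m ∈ M₃.ℳ (i + -1 - -1)
      rw [show i + -1 - -1 = i by ring]
      exact g.mem hm
    refine (h.qis (M := M₁) (N := ext M₂ (shift M₃ (-1)) g.toFun hgd g.comm)
      (LinearMap.inr A M₃.M M₂.M ∘ₗ f.toFun) ?_ ?_ ⟨?_, ?_⟩).2 (h.ext _ _ _ h2 (h.shift _ h3))
    · exact (inr_deg M₂ (shift M₃ (-1)) g.toFun hgd g.comm).comp (deg_of _ _ f) (by omega)
    · intro x
      show (0, f.toFun (M₁.d x)) = (ext M₂ (shift M₃ (-1)) g.toFun hgd g.comm).d (0, f.toFun x)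
      show _ = (M₃.d 0 + g.toFun (ε M₂ (f.toFun x)), M₂.d (f.toFun x))
      rw [← fe, gf, f.comm]; simp
    · rintro ⟨c, b⟩ hz
      rw [ext_d] at hz
      have e1 : M₃.d c + g.toFun (ε M₂ b) = 0 := congrArg Prod.fst hz
      have e2 : M₂.d b = 0 := congrArg Prod.snd hz
      obtain ⟨c', rfl⟩ := hs c
      obtain ⟨x, hx⟩ := (hex (M₂.d c' + ε M₂ b)).1 (by rw [map_add, g.comm, e1])
      have hdx : M₁.d x = 0 := hi (by
        rw [f.comm, hx, map_add, M₂.d_sq, ε_cyc, e2]; simp)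
      refine ⟨ε M₁ x, (0, - ε M₂ c'), by rw [ε_cyc, hdx]; simp, ?_⟩
      show (0, f.toFun (ε M₁ x)) = (g.toFun c', b) +
        (ext M₂ (shift M₃ (-1)) g.toFun hgd g.comm).d (0, - ε M₂ c')
      rw [fe, hx]
      refine Prod.ext ?_ ?_
      · show 0 = g.toFun c' + (M₃.d 0 + g.toFun (ε M₂ (-ε M₂ c')))
        simp [ε_ε]
      · show ε M₂ (M₂.d c' + ε M₂ b) = b + M₂.d (-ε M₂ c')
        rw [map_add, ε_ε, map_neg, ε_d]; abel
    · rintro x hx ⟨⟨w1, w2⟩, hw⟩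
      rw [ext_d] at hw
      have e1 : 0 = M₃.d w1 + g.toFun (ε M₂ w2) := congrArg Prod.fst hw
      have e2 : f.toFun x = M₂.d w2 := congrArg Prod.snd hw
      obtain ⟨c, rfl⟩ := hs w1
      obtain ⟨v, hv⟩ := (hex (M₂.d c + ε M₂ w2)).1 (by rw [map_add, g.comm, ← e1])
      refine ⟨ε M₁ v, hi ?_⟩
      rw [f.comm, fe, hv, map_add, ε_ε, map_add, ε_cyc, M₂.d_sq, e2]
      simp
  · intro M₁ M₂ M₃ f g hfg h1 h3
    have hF := (hcone f g hfg).2 h3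
    set F := cone (M := M₁) (N := M₂) f.toFun (deg_of _ _ f) f.comm with hFdef
    have hsd : Deg F M₁ (-1) (LinearMap.snd A M₂.M M₁.M) := by
      rintro i ⟨b, c⟩ hm
      exact hm.2
    have hsc : Cm F M₁ (LinearMap.snd A M₂.M M₁.M) := by
      rintro ⟨b, c⟩; rfl
    have Ed : ∀ a b c, (ext F M₁ (LinearMap.snd A M₂.M M₁.M) hsd hsc).d (a, (b, c)) =
        (M₁.d a + ε (shift M₁ 1) c, (M₂.d b + f.toFun (ε (shift M₁ 1) c), M₁.d c)) := by
      intro a b c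
      rw [ext_d, ε_ext]; rfl
    refine (h.qis (M := M₂) (N := ext F M₁ (LinearMap.snd A M₂.M M₁.M) hsd hsc)
      (LinearMap.inr A M₁.M (M₂.M × M₁.M) ∘ₗ LinearMap.inl A M₂.M M₁.M) ?_ ?_ ⟨?_, ?_⟩).2
      (h.ext _ _ _ hF h1)
    · intro i m hm
      rw [add_zero]
      exact ⟨zero_mem _, hm, zero_mem _⟩
    · intro b
      show (0, (M₂.d b, 0)) = (ext F M₁ (LinearMap.snd A M₂.M M₁.M) hsd hsc).d (0, (b, 0))
      rw [Ed]; simp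
    · rintro ⟨a, b, c⟩ hz
      rw [Ed] at hz
      have e1 : M₁.d a + ε (shift M₁ 1) c = 0 := congrArg Prod.fst hz
      have e2 : M₂.d b + f.toFun (ε (shift M₁ 1) c) = 0 := congrArg (fun x => x.2.1) hz
      have e3 : ε (shift M₁ 1) c = - M₁.d a := eq_neg_of_add_eq_zero_right e1
      have e4 : c = - ε (shift M₁ 1) (M₁.d a) := by
        rw [← map_neg, ← e3, ε_ε]
      rw [e3, map_neg, f.comm] at e2
      refine ⟨b - f.toFun a, (0, (0, - ε (shift M₁ 1) a)), ?_, ?_⟩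
      · rw [map_sub, sub_eq_add_neg, e2]
      · rw [Ed]
        show (0, (b - f.toFun a, 0)) = (a, (b, c)) + _
        have e5 : M₁.d (ε (shift M₁ 1) a) = - ε (shift M₁ 1) (M₁.d a) := ε_cyc (shift M₁ 1) a
        rw [map_neg, ε_ε, map_neg M₁.d, e5, e4]
        simp [sub_eq_add_neg]
    · rintro b hb ⟨⟨w1, w2, w3⟩, hw⟩
      rw [Ed] at hw
      have e1 : 0 = M₁.d w1 + ε (shift M₁ 1) w3 := congrArg Prod.fst hw
      have e2 : b = M₂.d w2 + f.toFun (ε (shift M₁ 1) w3) := congrArg (fun x => x.2.1) hw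
      refine ⟨w2 - f.toFun w1, ?_⟩
      rw [e2, eq_neg_of_add_eq_zero_right e1.symm, map_neg, f.comm, map_sub, sub_eq_add_neg]
  · intro M₁ M₂ M₃ f g hfg h1 h2
    exact (hcone f g hfg).1 (h.ext _ _ _ (h.shift 1 h1) h2)

lemma retract_qis {N X : DGMod A 𝒜 dA} {i : DGHom N X} {r : DGHom X N} {h : N.M →+ N.M}
    (hh : ∀ m, r.toFun (i.toFun m) - m = N.d (h m) + h (N.d m)) :
    Qis N N (r.toFun ∘ₗ i.toFun) := by
  constructor
  · intro z hz
    refine ⟨z, h z, hz, ?_⟩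
    have := hh z
    rw [hz, map_zero, add_zero] at this
    rw [← this]; simp
  · rintro z hz ⟨w, hw⟩
    refine ⟨w - h z, ?_⟩
    have := hh z
    rw [hz, map_zero, add_zero] at this
    rw [map_sub, ← this, ← hw]; simp

end DGX
end

noncomputable section
namespace DGX
open DirectSum

/-- `N` is killed by the annihilator of `u` -/
def Kil (Z : DGMod A 𝒜 dA) (u : Z.M) (N : DGMod A 𝒜 dA) : Prop :=
  ∀ a : A, a • u = 0 → ∀ x : N.M, a • x = 0

lemma fr_of_kil {Z N : DGMod A 𝒜 dA} {u : Z.M} (h : IsGen Z u) (hk : Kil Z u N) : Fr Z u N := by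
  intro x
  choose c hc using h.surj
  have key : ∀ a b : A, a • u = b • u → a • x = b • x := by
    intro a b hab
    have := hk (a - b) (by rw [sub_smul, hab, sub_self]) x
    rwa [sub_smul, sub_eq_zero] at this
  refine ⟨{ toFun := fun z => c z • x, map_add' := ?_, map_smul' := ?_ }, ?_⟩
  · intro y z
    rw [← add_smul]
    exact key _ _ (by rw [add_smul, hc, hc, hc])
  · intro a z
    simp only [RingHom.id_apply]
    rw [smul_smul]
    exact key _ _ (by rw [mul_smul, hc, hc])
  · show c u • x = x
    conv_rhs => rw [← one_smul A x]
    exact key _ _ (by rw [hc, one_smul])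

/-- closure properties for resolutions -/
structure ClR (P : DGMod A 𝒜 dA → Prop) : Prop where
  shift : ∀ {M : DGMod A 𝒜 dA} (n : ℤ), P M → P (shift M n)
  ext : ∀ {M N : DGMod A 𝒜 dA} (τ : M.M →ₗ[A] N.M) (hd : Deg M N (-1) τ) (hc : Cm M N τ),
    P M → P N → P (ext M N τ hd hc)
  coprod : ∀ {ι : Type} (F : ι → DGMod A 𝒜 dA), (∀ i, P (F i)) → P (coprod F)

lemma clr_kil (Z : DGMod A 𝒜 dA) (u : Z.M) : ClR (Kil Z u) where
  shift := fun n h a ha x => h a ha x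
  ext := fun τ hd hc h h' a ha x => Prod.ext (h' a ha x.1) (h a ha x.2)
  coprod := fun F h a ha x => by
    refine DFinsupp.ext (fun i => ?_)
    rw [DFinsupp.smul_apply]
    exact h i a ha _

lemma kp_clr : ClR (Kp : DGMod A 𝒜 dA → Prop) where
  shift := fun n h => h.shift n
  ext := fun τ hd hc h h' => h.ext h' τ hd hc
  coprod := fun F h => Kp.coprod h

lemma ClR.and {P Q : DGMod A 𝒜 dA → Prop} (hP : ClR P) (hQ : ClR Q) :
    ClR (fun M => P M ∧ Q M) where
  shift := fun n h => ⟨hP.shift n h.1, hQ.shift n h.2⟩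
  ext := fun τ hd hc h h' => ⟨hP.ext τ hd hc h.1 h'.1, hQ.ext τ hd hc h.2 h'.2⟩
  coprod := fun F h => ⟨hP.coprod F (fun i => (h i).1), hQ.coprod F (fun i => (h i).2)⟩

section cop
variable {ι : Type} (F : ι → DGMod A 𝒜 dA)

lemma cop_cyc_induction {C : (coprod F).M → Prop} (h0 : C 0)
    (hi : ∀ i x, (F i).d x = 0 → C (inc F i x))
    (ha : ∀ x y, C x → C y → C (x + y)) (x : (coprod F).M) (hx : (coprod F).d x = 0) : C x := by
  classical
  have h1 : ∑ i ∈ DFinsupp.support (β := fun i => (F i).M) x, inc F i (prj F i x) = x :=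
    DFinsupp.sum_single (β := fun i => (F i).M) (f := x)
  rw [← h1]
  refine Finset.sum_induction _ C ha h0 (fun i _ => hi i _ ?_)
  rw [← prj_cm, hx, map_zero]

lemma cop_bdry (c : (coprod F).M) (h : ∀ i, ∃ e, prj F i c = (F i).d e) :
    ∃ e, c = (coprod F).d e := by
  classical
  have h1 : ∑ i ∈ DFinsupp.support (β := fun i => (F i).M) c, inc F i (prj F i c) = c :=
    DFinsupp.sum_single (β := fun i => (F i).M) (f := c)
  rw [← h1]
  refine Finset.sum_induction _ (fun c => ∃ e, c = (coprod F).d e) ?_ ⟨0, by simp⟩ (fun i _ => ?_)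
  · rintro x y ⟨e, rfl⟩ ⟨e', rfl⟩; exact ⟨e + e', by rw [map_add]⟩
  · obtain ⟨e, he⟩ := h i
    exact ⟨inc F i e, by rw [he, inc_cm]⟩

end cop

/-- stage of the resolution -/
structure Stg (P : DGMod A 𝒜 dA → Prop) (N : DGMod A 𝒜 dA) where
  X : DGMod A 𝒜 dA
  φ : X.M →ₗ[A] N.M
  hd : Deg X N 0 φ
  hc : Cm X N φ
  hP : P X

lemma shift_deg {Z X : DGMod A 𝒜 dA} {ψ : Z.M →ₗ[A] X.M} {n : ℤ} (h : Deg Z X n ψ) (k l : ℤ)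
    (e : l + k = n) : Deg (shift Z k) X l ψ := by
  intro i m hm
  have := h _ _ hm
  rwa [show i - k + n = i + l by omega] at this

lemma stage0 (hA : IsDGAlgebra A 𝒜 dA) {P : DGMod A 𝒜 dA → Prop} (hP : ClR P)
    {Z : DGMod A 𝒜 dA} {u : Z.M} (hu : IsGen Z u) (hZ : P Z) {N : DGMod A 𝒜 dA} (hN : Fr Z u N) :
    ∃ S : Stg P N, ∀ z, N.d z = 0 → ∃ z', S.X.d z' = 0 ∧ S.φ z' = z := by
  let I : Type := {j : ℤ × N.M // j.2 ∈ N.ℳ j.1 ∧ N.d j.2 = 0}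
  choose ψ hψ using hN
  let F : I → DGMod A 𝒜 dA := fun j => shift Z j.1.1
  let f : ∀ j : I, (F j).M →ₗ[A] N.M := fun j => ψ j.1.2
  refine ⟨⟨coprod F, desc F N f, desc_deg F N 0 f ?_, desc_cm F N f ?_,
    hP.coprod F (fun j => hP.shift _ hZ)⟩, ?_⟩
  · intro j
    exact shift_deg (hu.deg hA (n := j.1.1) (by rw [hψ]; exact j.2.1)) _ _ (by omega)
  · intro j
    exact hu.cm hA (by rw [hψ]; exact j.2.2)
  · intro z hz
    refine exists_sum_lift (C := fun z => ∃ z', (coprod F).d z' = 0 ∧ desc F N f z' = z) z ?_ ?_ ?_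
    · intro i
      have hj : p N i z ∈ N.ℳ i ∧ N.d (p N i z) = 0 := by
        refine ⟨gp_mem _ _ _, ?_⟩
        have := p_d N (i - 1) z
        rw [hz, map_zero, sub_add_cancel] at this
        exact this.symm
      let j : I := ⟨(i, p N i z), hj⟩
      refine ⟨inc F j u, ?_, ?_⟩
      · rw [← inc_cm]
        have : (F j).d u = 0 := hu.du
        rw [this, map_zero]
      · rw [desc_inc]; exact hψ _
    · exact ⟨0, by simp, by simp⟩
    · rintro x y ⟨a, ha, rfl⟩ ⟨b, hb, rfl⟩
      exact ⟨a + b, by rw [map_add, ha, hb, add_zero], by rw [map_add]⟩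

lemma stageS (hA : IsDGAlgebra A 𝒜 dA) {P : DGMod A 𝒜 dA → Prop} (hP : ClR P)
    {Z : DGMod A 𝒜 dA} {u : Z.M} (hu : IsGen Z u) (hZ : P Z) {N : DGMod A 𝒜 dA} (hN : Fr Z u N)
    (hF : ∀ M, P M → Fr Z u M) (S : Stg P N) :
    ∃ (S' : Stg P N) (s : S.X.M →ₗ[A] S'.X.M), Deg S.X S'.X 0 s ∧ Cm S.X S'.X s ∧
      (∀ x, S'.φ (s x) = S.φ x) ∧
      ∀ x w, S.X.d x = 0 → S.φ x = N.d w → ∃ v, s x = S'.X.d v := by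
  let X := S.X
  let I : Type := {j : ℤ × X.M × N.M // j.2.1 ∈ X.ℳ j.1 ∧ X.d j.2.1 = 0 ∧ j.2.2 ∈ N.ℳ (j.1 + 1) ∧
    S.φ j.2.1 = N.d j.2.2}
  choose ψ hψ using hN
  choose χ hχ using hF X S.hP
  let F : I → DGMod A 𝒜 dA := fun j => shift Z (j.1.1 + 1)
  let f : ∀ j : I, (F j).M →ₗ[A] N.M := fun j => sgn (j.1.1 + 1) • ψ j.1.2.2
  let t : ∀ j : I, (F j).M →ₗ[A] X.M := fun j => χ j.1.2.1
  have htd : Deg (coprod F) X (-1) (desc F X t) := desc_deg F X (-1) t (fun j =>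
    shift_deg (hu.deg hA (n := j.1.1) (by rw [hχ]; exact j.2.1)) _ _ (by omega))
  have htc : Cm (coprod F) X (desc F X t) := desc_cm F X t (fun j =>
    hu.cm hA (by rw [hχ]; exact j.2.2.1))
  have hfd : Deg (coprod F) N 0 (desc F N f) := desc_deg F N 0 f (fun j => by
    refine Deg.zsmul ?_ _
    exact shift_deg (hu.deg hA (n := j.1.1 + 1) (by rw [hψ]; exact j.2.2.2.1)) _ _ (by omega))
  have key : ∀ y, S.φ (desc F X t (ε (coprod F) y)) + desc F N f ((coprod F).d y) =
      N.d (desc F N f y) := by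
    intro y
    refine cop_ext F ((S.φ.toAddMonoidHom.comp (desc F X t).toAddMonoidHom).comp (ε (coprod F)) +
      (desc F N f).toAddMonoidHom.comp (coprod F).d) (N.d.comp (desc F N f).toAddMonoidHom) ?_ y
    intro j y
    show S.φ (desc F X t (ε (coprod F) (inc F j y))) + desc F N f ((coprod F).d (inc F j y)) =
      N.d (desc F N f (inc F j y))
    rw [ε_inc, ← inc_cm, desc_inc, desc_inc, desc_inc]
    show S.φ (χ j.1.2.1 (ε (shift Z (j.1.1 + 1)) y)) + sgn (j.1.1 + 1) • ψ j.1.2.2 (Z.d y) =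
      N.d (sgn (j.1.1 + 1) • ψ j.1.2.2 y)
    have h2 := hu.htpy hA (ψ := ψ j.1.2.2) (f := S.φ ∘ₗ χ j.1.2.1) (by
      rw [LinearMap.comp_apply, hψ, hχ]; exact j.2.2.2.2) y
    rw [LinearMap.comp_apply] at h2
    rw [ε_shift, map_zsmul, map_zsmul, h2, map_zsmul, ← smul_add, sub_add_cancel]
  refine ⟨⟨ext (coprod F) X (desc F X t) htd htc, S.φ.coprod (desc F N f),
    coprod_deg htd htc S.hd hfd, ?_, hP.ext _ _ _ (hP.coprod F (fun j => hP.shift _ hZ)) S.hP⟩,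
    LinearMap.inl A X.M (coprod F).M, inl_deg _ _ _ htd htc, inl_cm _ _ _ htd htc, ?_, ?_⟩
  · rintro ⟨x, y⟩
    show S.φ (X.d x + desc F X t (ε (coprod F) y)) + desc F N f ((coprod F).d y) =
      N.d (S.φ x + desc F N f y)
    rw [map_add, add_assoc, key, map_add, S.hc]
  · intro x
    show S.φ x + desc F N f 0 = _
    simp
  · intro x w hx hw
    show ∃ v, ((x, 0) : X.M × (coprod F).M) = (ext (coprod F) X (desc F X t) htd htc).d v
    have : ∀ i, S.φ (p X i x) = N.d (p N (i + 1) w) := by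
      intro i
      have h1 := p_f S.hd i x
      rw [add_zero, hw, p_d] at h1
      exact h1.symm
    refine exists_sum_lift (C := fun x => ∃ v, ((x, 0) : X.M × (coprod F).M) =
      (ext (coprod F) X (desc F X t) htd htc).d v) x ?_ ?_ ?_
    · intro i
      have hj : p X i x ∈ X.ℳ i ∧ X.d (p X i x) = 0 ∧ p N (i + 1) w ∈ N.ℳ (i + 1) ∧
          S.φ (p X i x) = N.d (p N (i + 1) w) := by
        refine ⟨gp_mem _ _ _, ?_, gp_mem _ _ _, this i⟩
        have := p_d X (i - 1) x
        rw [hx, map_zero, sub_add_cancel] at this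
        exact this.symm
      let j : I := ⟨(i, p X i x, p N (i + 1) w), hj⟩
      refine ⟨(0, sgn (i + 1) • inc F j u), ?_⟩
      show _ = (X.d 0 + desc F X t (ε (coprod F) (sgn (i + 1) • inc F j u)),
        (coprod F).d (sgn (i + 1) • inc F j u))
      have h3 : (F j).d u = 0 := hu.du
      have h4 : ε (F j) u = sgn (i + 1) • ε Z u := ε_shift Z (i + 1) u
      have h5 : ε Z u = u := by rw [ε_mem Z hu.mem]; simp
      rw [map_zsmul, ε_inc, map_zsmul, desc_inc, h4, map_zsmul, smul_smul, sgn_mul_self, one_smul,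
        map_zsmul, ← inc_cm, h3, h5]
      have h6 : t j u = p X i x := hχ _
      rw [h6]; simp
    · exact ⟨0, by simp⟩
    · rintro x y ⟨a, ha⟩ ⟨b, hb⟩
      refine ⟨a + b, ?_⟩
      rw [map_add, ← ha, ← hb]; simp

lemma aux_abel {G : Type} [AddCommGroup G] (a b c d : G) :
    a + b + c = d + (c + b + (a - d)) := by abel

theorem resolve (hA : IsDGAlgebra A 𝒜 dA) {P : DGMod A 𝒜 dA → Prop} (hP : ClR P)
    {Z : DGMod A 𝒜 dA} {u : Z.M} (hu : IsGen Z u) (hZ : P Z) {N : DGMod A 𝒜 dA} (hN : Fr Z u N)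
    (hF : ∀ M, P M → Fr Z u M) :
    ∃ (X : DGMod A 𝒜 dA) (q : X.M →ₗ[A] N.M), P X ∧ Deg X N 0 q ∧ Cm X N q ∧ Qis X N q := by
  obtain ⟨S0, hS0⟩ := stage0 hA hP hu hZ hN
  choose nx sx hsd hsc hsφ hkill using stageS hA hP hu hZ hN hF
  let S : ℕ → Stg P N := fun k => Nat.rec S0 (fun _ T => nx T) k
  let X : ℕ → DGMod A 𝒜 dA := fun k => (S k).X
  let s : ∀ k, (X k).M →ₗ[A] (X (k + 1)).M := fun k => sx (S k)
  let φ : ∀ k, (X k).M →ₗ[A] N.M := fun k => (S k).φ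
  have hsd : ∀ k, Deg (X k) (X (k + 1)) 0 (s k) := fun k => hsd (S k)
  have hsc : ∀ k, Cm (X k) (X (k + 1)) (s k) := fun k => hsc (S k)
  have hsφ : ∀ k x, φ (k + 1) (s k x) = φ k x := fun k => hsφ (S k)
  have hkill : ∀ k x w, (X k).d x = 0 → φ k x = N.d w → ∃ v, s k x = (X (k + 1)).d v :=
    fun k => hkill (S k)
  let B := coprod X
  let g : ∀ k, (X k).M →ₗ[A] B.M := fun k => inc X (k + 1) ∘ₗ s k
  let σ : B.M →ₗ[A] B.M := desc X B g
  have hσd : Deg B B 0 σ := desc_deg X B 0 g (fun k => (inc_deg X (k + 1)).comp (hsd k) (by omega))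
  have hσc : Cm B B σ := desc_cm X B g (fun k => (inc_cm X (k + 1)).comp (hsc k))
  let t : B.M →ₗ[A] B.M := LinearMap.id - σ
  have htd : Deg B B 0 t := Deg.id.sub hσd
  have htc : Cm B B t := Cm.id.sub hσc
  let Φ : B.M →ₗ[A] N.M := desc X N φ
  have hΦd : Deg B N 0 Φ := desc_deg X N 0 φ (fun k => (S k).hd)
  have hΦc : Cm B N Φ := desc_cm X N φ (fun k => (S k).hc)
  have hσi : ∀ k x, σ (inc X k x) = inc X (k + 1) (s k x) := fun k x => desc_inc X B g k x
  have hΦt : ∀ b, Φ (t b) = 0 := by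
    intro b
    refine cop_ext X (Φ.toAddMonoidHom.comp t.toAddMonoidHom) 0 ?_ b
    intro k x
    show Φ (inc X k x - σ (inc X k x)) = 0
    rw [hσi, map_sub, desc_inc, desc_inc, hsφ, sub_self]
  have hbound : ∀ b a, B.d b = 0 → t b = B.d a → ∃ e, b = B.d e := by
    intro b a hb hab
    refine cop_bdry X b (fun k => ?_)
    have h0 : prj X 0 (σ b) = 0 := by
      refine cop_ext X ((prj X 0).toAddMonoidHom.comp σ.toAddMonoidHom) 0 ?_ b
      intro k x
      show prj X 0 (σ (inc X k x)) = 0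
      rw [hσi, prj_inc_ne]; omega
    have h1 : ∀ k, prj X (k + 1) (σ b) = s k (prj X k b) := by
      intro k
      refine cop_ext X ((prj X (k + 1)).toAddMonoidHom.comp σ.toAddMonoidHom)
        ((s k).toAddMonoidHom.comp (prj X k).toAddMonoidHom) ?_ b
      intro l x
      show prj X (k + 1) (σ (inc X l x)) = s k (prj X k (inc X l x))
      rw [hσi]
      by_cases h : l = k
      · subst h; rw [prj_inc_same, prj_inc_same]
      · rw [prj_inc_ne X _ _ h, prj_inc_ne X _ _ (by omega), map_zero]
    have h2 : ∀ k, prj X k b - prj X k (σ b) = (X k).d (prj X k a) := by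
      intro k
      rw [← prj_cm, ← map_sub, ← hab]; rfl
    induction k with
    | zero => exact ⟨prj X 0 a, by rw [← h2, h0, sub_zero]⟩
    | succ k ih =>
      obtain ⟨e, he⟩ := ih
      refine ⟨prj X (k + 1) a + s k e, ?_⟩
      have h3 := h2 (k + 1)
      rw [h1, he, hsc] at h3
      rw [map_add]
      exact sub_eq_iff_eq_add.mp h3
  have hpush : ∀ a, B.d a = 0 → ∃ K0 : ℕ, ∀ K, K0 ≤ K → ∃ x e, (X K).d x = 0 ∧ B.d e = 0 ∧
      a = inc X K x + t e := by
    intro a ha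
    refine cop_cyc_induction X (C := fun a => ∃ K0 : ℕ, ∀ K, K0 ≤ K → ∃ x e, (X K).d x = 0 ∧
      B.d e = 0 ∧ a = inc X K x + t e) ?_ ?_ ?_ a ha
    · exact ⟨0, fun K _ => ⟨0, 0, by simp, by simp, by simp⟩⟩
    · intro k x hx
      refine ⟨k, fun K hK => ?_⟩
      induction K, hK using Nat.le_induction with
      | base => exact ⟨x, 0, hx, by simp, by simp⟩
      | succ K hK ih =>
        obtain ⟨y, e, hy, he, h⟩ := ih
        refine ⟨s K y, inc X K y + e, ?_, ?_, ?_⟩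
        · rw [← hsc, hy, map_zero]
        · rw [map_add, he, ← inc_cm, hy]; simp
        · rw [h]
          show _ = _ + ((inc X K y + e) - σ (inc X K y + e))
          rw [map_add, hσi]
          show _ + (e - σ e) = _
          abel
    · rintro x y ⟨K0, h0⟩ ⟨K1, h1⟩
      refine ⟨max K0 K1, fun K hK => ?_⟩
      obtain ⟨x0, e0, h2, h3, rfl⟩ := h0 K (le_trans (le_max_left _ _) hK)
      obtain ⟨x1, e1, h4, h5, rfl⟩ := h1 K (le_trans (le_max_right _ _) hK)
      refine ⟨x0 + x1, e0 + e1, by rw [map_add, h2, h4, add_zero], by rw [map_add, h3, h5, add_zero],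
        ?_⟩
      rw [map_add, map_add]; abel
  have hte : ∀ e, ε B (t e) = t (ε B e) := fun e => ε_f0 htd e
  refine ⟨cone (M := B) (N := B) t htd htc, Φ ∘ₗ LinearMap.fst A B.M B.M, ?_, ?_, ?_, ?_, ?_⟩
  · exact hP.ext _ _ _ (hP.shift 1 (hP.coprod X (fun k => (S k).hP)))
      (hP.coprod X (fun k => (S k).hP))
  · exact hΦd.comp (fst_deg (shift B 1) B t (deg_cone htd) htc) (by omega)
  · rintro ⟨a, b⟩
    show Φ (B.d a + t (ε (shift B 1) b)) = N.d (Φ a)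
    rw [map_add, hΦt, add_zero, hΦc]
  · intro z hz
    obtain ⟨z', h1, h2⟩ := hS0 z hz
    refine ⟨(inc X 0 z', 0), 0, ?_, ?_⟩
    · show (B.d (inc X 0 z') + t (ε (shift B 1) 0), B.d 0) = 0
      have : (X 0).d z' = 0 := h1
      rw [← inc_cm, this]; simp
    · show Φ (inc X 0 z') = _
      rw [desc_inc, map_zero, add_zero]; exact h2
  · rintro ⟨a, b⟩ hz ⟨w, hw⟩
    have e1 : B.d a + t (ε (shift B 1) b) = 0 := congrArg Prod.fst hz
    have e2 : B.d b = 0 := congrArg Prod.snd hz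
    have hw : Φ a = N.d w := hw
    rw [ε_shift_one, map_neg, add_neg_eq_zero] at e1
    obtain ⟨e, he⟩ := hbound (ε B b) a (by rw [ε_cyc, e2]; simp) e1.symm
    have hb : b = B.d (- ε B e) := by
      rw [map_neg, ε_cyc, ← he, ε_ε, neg_neg]
    obtain ⟨K, hK⟩ := hpush (a - t e) (by rw [map_sub, e1, he, ← htc, sub_self])
    obtain ⟨x, e', hx, he', hae⟩ := hK K le_rfl
    have hφx : φ K x = N.d w := by
      have := congrArg Φ hae
      rw [map_sub, map_add, hΦt, hΦt, desc_inc, add_zero, sub_zero, hw] at this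
      exact this.symm
    obtain ⟨v, hv⟩ := hkill K x w hx hφx
    refine ⟨(inc X (K + 1) v, - ε B (e + e' + inc X K x)), ?_⟩
    show (a, b) = (B.d (inc X (K + 1) v) + t (ε (shift B 1) (- ε B (e + e' + inc X K x))),
      B.d (- ε B (e + e' + inc X K x)))
    refine Prod.ext ?_ ?_
    · show a = _
      rw [ε_shift_one, map_neg (ε B), ε_ε, neg_neg, map_add, map_add, ← inc_cm, ← hv, ← hσi]
      have : t (inc X K x) = inc X K x - σ (inc X K x) := rfl
      rw [this, eq_add_of_sub_eq hae]
      exact aux_abel _ _ _ _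
    · show b = B.d (- ε B (e + e' + inc X K x))
      rw [hb, map_neg, map_neg, ε_cyc, ε_cyc, map_add B.d, map_add B.d, he', ← inc_cm, hx]; simp

theorem kp_res (hA : IsDGAlgebra A 𝒜 dA) (N : DGMod A 𝒜 dA) :
    ∃ (X : DGMod A 𝒜 dA) (q : X.M →ₗ[A] N.M), Kp X ∧ Deg X N 0 q ∧ Cm X N q ∧ Qis X N q :=
  resolve hA kp_clr (gen_one hA) (kp_A hA) (fr_one hA N) (fun M _ => fr_one hA M)

theorem kil_res (hA : IsDGAlgebra A 𝒜 dA) {P : DGMod A 𝒜 dA → Prop} (hP : ClR P)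
    {Z : DGMod A 𝒜 dA} {u : Z.M} (hu : IsGen Z u) (hZ : P Z) (hZ' : Kil Z u Z)
    {N : DGMod A 𝒜 dA} (hN : Kil Z u N) :
    ∃ (X : DGMod A 𝒜 dA) (q : X.M →ₗ[A] N.M), P X ∧ Deg X N 0 q ∧ Cm X N q ∧ Qis X N q := by
  obtain ⟨X, q, h, h'⟩ := resolve hA (hP.and (clr_kil Z u)) hu ⟨hZ, hZ'⟩ (fr_of_kil hu hN)
    (fun M hM => fr_of_kil hu hM.2)
  exact ⟨X, q, h.1, h'⟩

end DGX
end

noncomputable section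
namespace DGX
open DirectSum

/-- strict small models -/
def Sm (C : DGMod A 𝒜 dA) : Prop := Kp C ∧ Cpt C

lemma Sm.shift {C : DGMod A 𝒜 dA} (h : Sm C) (n : ℤ) : Sm (shift C n) :=
  ⟨h.1.shift n, fun ι F => (h.2 ι F).shift n⟩

lemma Sm.ext {C C' : DGMod A 𝒜 dA} (h : Sm C) (h' : Sm C') (τ : C.M →ₗ[A] C'.M)
    (hd : Deg C C' (-1) τ) (hc : Cm C C' τ) : Sm (ext C C' τ hd hc) :=
  ⟨h.1.ext h'.1 τ hd hc, fun ι F => Tst.ext (adm_cof F) (h.2 ι F) (h'.2 ι F) τ hd hc⟩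

lemma sm_A (hA : IsDGAlgebra A 𝒜 dA) : Sm (aMod hA) := ⟨kp_A hA, cpt_A hA⟩

/-- objects with small model -/
def HSm (X : DGMod A 𝒜 dA) : Prop :=
  ∃ (X' : DGMod A 𝒜 dA) (q : X'.M →ₗ[A] X.M), Sm X' ∧ Deg X' X 0 q ∧ Cm X' X q ∧ Qis X' X q

lemma null_symm {M N : DGMod A 𝒜 dA} {n : ℤ} {f g : M.M →ₗ[A] N.M} (h : Null M N n (f - g)) :
    Null M N n (g - f) := by
  have := h.neg
  rwa [neg_sub] at this

section extq
variable {M N M' N' : DGMod A 𝒜 dA} {τ : M.M →ₗ[A] N.M} (hd : Deg M N (-1) τ) (hc : Cm M N τ)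
  {τ' : M'.M →ₗ[A] N'.M} (hd' : Deg M' N' (-1) τ') (hc' : Cm M' N' τ')
  {a : M'.M →ₗ[A] M.M} {b : N'.M →ₗ[A] N.M} {k : M'.M →ₗ[A] N.M}

/-- map of extensions -/
def extm (a : M'.M →ₗ[A] M.M) (b : N'.M →ₗ[A] N.M) (k : M'.M →ₗ[A] N.M) :
    (N'.M × M'.M) →ₗ[A] (N.M × M.M) :=
  (b ∘ₗ LinearMap.fst A N'.M M'.M - k ∘ₗ LinearMap.snd A N'.M M'.M).prod
    (a ∘ₗ LinearMap.snd A N'.M M'.M)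

lemma extm_deg (had : Deg M' M 0 a) (hbd : Deg N' N 0 b) (hk : Deg M' N 0 k) :
    Deg (ext M' N' τ' hd' hc') (ext M N τ hd hc) 0 (extm a b k) := by
  rintro i ⟨x, y⟩ ⟨h1, h2⟩
  exact ⟨(N.ℳ (i + 0)).sub_mem (hbd _ _ h1) (hk _ _ h2), had _ _ h2⟩

lemma extm_cm (had : Deg M' M 0 a) (hac : Cm M' M a) (hbc : Cm N' N b)
    (ek : ∀ m, τ (a (ε M' m)) - b (τ' (ε M' m)) = N.d (k m) - k (M'.d m)) :
    Cm (ext M' N' τ' hd' hc') (ext M N τ hd hc) (extm a b k) := by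
  rintro ⟨x, y⟩
  show (b (N'.d x + τ' (ε M' y)) - k (M'.d y), a (M'.d y)) =
    (N.d (b x - k y) + τ (ε M (a y)), M.d (a y))
  refine Prod.ext ?_ (hac y)
  show b (N'.d x + τ' (ε M' y)) - k (M'.d y) = N.d (b x - k y) + τ (ε M (a y))
  have h1 := ek y
  rw [ε_f0 had, map_add, map_sub, hbc]
  rw [sub_eq_iff_eq_add] at h1
  rw [h1]; abel

lemma extm_qis (had : Deg M' M 0 a) (hac : Cm M' M a) (hbc : Cm N' N b)
    (ek : ∀ m, τ (a (ε M' m)) - b (τ' (ε M' m)) = N.d (k m) - k (M'.d m))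
    (ha : Qis M' M a) (hb : Qis N' N b) :
    Qis (ext M' N' τ' hd' hc') (ext M N τ hd hc) (extm a b k) := by
  constructor
  · rintro ⟨n, m⟩ hz
    have z1 : N.d n + τ (ε M m) = 0 := congrArg Prod.fst hz
    have z2 : M.d m = 0 := congrArg Prod.snd hz
    obtain ⟨m', w, h1, h2⟩ := ha.1 m z2
    have e1 := ek m'
    rw [h1, map_zero, sub_zero, ← ε_f0 had, h2, map_add, map_add, ε_d, map_neg, hc] at e1
    have e2 : τ (ε M m) = - N.d n := eq_neg_of_add_eq_zero_right z1
    obtain ⟨v, hv⟩ := hb.2 (τ' (ε M' m')) (by rw [← hc', ε_cyc, h1]; simp)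
      ⟨-n - τ (ε M w) - k m', by
        rw [map_sub, map_sub, map_neg, ← e1, e2]; abel⟩
    have e3 : N.d (b v) = N.d (-n - τ (ε M w) - k m') := by
      rw [← hbc, ← hv, map_sub, map_sub, map_neg, ← e1, e2]; abel
    obtain ⟨x1, w', h3, h4⟩ := hb.1 (n + b v + k m' + τ (ε M w)) (by
      rw [map_add, map_add, map_add, e3, map_sub, map_sub, map_neg]; abel)
    refine ⟨(x1 - v, m'), (w', w), ?_, ?_⟩
    · show (N'.d (x1 - v) + τ' (ε M' m'), M'.d m') = 0
      rw [map_sub, h3, hv, h1]; simp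
    · show (b (x1 - v) - k m', a m') = (n + (N.d w' + τ (ε M w)), m + M.d w)
      rw [h2, map_sub, h4]
      refine Prod.ext ?_ rfl
      show _ = _
      simp only
      abel
  · rintro ⟨x, y⟩ hz ⟨⟨w1, w2⟩, hw⟩
    have z1 : N'.d x + τ' (ε M' y) = 0 := congrArg Prod.fst hz
    have z2 : M'.d y = 0 := congrArg Prod.snd hz
    have hw1 : b x - k y = N.d w1 + τ (ε M w2) := congrArg Prod.fst hw
    have hw2 : a y = M.d w2 := congrArg Prod.snd hw
    obtain ⟨y', rfl⟩ := ha.2 y z2 ⟨w2, hw2⟩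
    obtain ⟨c, w3, h1, h2⟩ := ha.1 (w2 - a y') (by rw [map_sub, ← hw2, hac, sub_self])
    have e1 := ek y'
    have e2 := ek c
    rw [h1, map_zero, sub_zero, ← ε_f0 had, h2] at e2
    rw [← ε_f0 had] at e1
    simp only [map_add, map_sub, ε_d, map_neg, hc _] at e2
    obtain ⟨x3, h3⟩ := hb.2 (x - τ' (ε M' y') - τ' (ε M' c)) (by
      rw [map_sub, map_sub, ← hc', ← hc', ε_cyc, ε_cyc, h1]
      rw [ε_d] at z1
      rw [ε_d]
      simpa [sub_eq_add_neg] using z1) ⟨w1 + k y' + k c + τ (ε M w3), by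
        simp only [map_add, map_sub]
        rw [sub_eq_iff_eq_add] at e1 e2 hw1
        rw [hw1, ← sub_eq_zero]
        have e3 : τ (ε M w2) = τ (ε M (a y')) + N.d (τ (ε M w3)) + (N.d (k c) + b (τ' (ε M' c))) := by
          rw [← e2]; abel
        rw [e3, e1]; abel⟩
    refine ⟨(x3, y' + c), ?_⟩
    show (x, M'.d y') = (N'.d x3 + τ' (ε M' (y' + c)), M'.d (y' + c))
    rw [← h3, map_add, map_add, map_add, h1, add_zero]
    refine Prod.ext ?_ rfl
    simp only
    abel
end extq

lemma hsm_cl (hA : IsDGAlgebra A 𝒜 dA) : Cl (HSm : DGMod A 𝒜 dA → Prop) where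
  qis := by
    intro M N f hf hfc hq
    constructor
    · rintro ⟨X', q, hX, h1, h2, h3⟩
      exact ⟨X', f ∘ₗ q, hX, hf.comp h1 (by omega), hfc.comp h2, hq.comp h3 hfc h2⟩
    · rintro ⟨X', q, hX, h1, h2, h3⟩
      obtain ⟨f', h4, h5, h6⟩ := hX.1.lift hf hfc hq h1 h2
      exact ⟨X', f', hX, h4, h5, hq.of_comp (h3.of_null h6) hfc h5⟩
  shift := by
    rintro M n ⟨X', q, hX, h1, h2, h3⟩
    refine ⟨shift X' n, q, hX.shift n, ?_, h2, h3⟩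
    intro i m hm
    have := h1 _ _ hm
    show q m ∈ M.ℳ (i + 0 - n)
    rwa [show i + 0 - n = i - n + 0 by ring]
  ext := by
    rintro M N τ hd hc ⟨M', a, hM, ha1, ha2, ha3⟩ ⟨N', b, hN, hb1, hb2, hb3⟩
    obtain ⟨τ', h1, h2, k, hk, ek⟩ := hM.1.lift hb1 hb2 hb3 (hd.comp ha1 (n' := -1) (by omega))
      (hc.comp ha2)
    exact ⟨_, extm a b k, hM.ext hN τ' h1 h2, extm_deg hd hc h1 h2 ha1 hb1 hk,
      extm_cm hd hc h1 h2 ha1 ha2 hb2 ek, extm_qis hd hc h1 h2 ha1 ha2 hb2 ek ha3 hb3⟩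
  retract := by
    rintro X Y ⟨i, r, h, hh, he⟩ ⟨Y', qY, hY, hY1, hY2, hY3⟩
    obtain ⟨X', qX, hX, hX1, hX2, hX3⟩ := kp_res hA X
    have id1 := deg_of _ _ i
    have rd := deg_of _ _ r
    obtain ⟨u, hu1, hu2, hu3⟩ := hX.lift hY1 hY2 hY3 (id1.comp hX1 (n' := 0) (by omega))
      (Cm.comp (L := Y) i.comm hX2)
    obtain ⟨v, hv1, hv2, hv3⟩ := hY.1.lift hX1 hX2 hX3 (rd.comp hY1 (n' := 0) (by omega))
      (Cm.comp (L := X) r.comm hY2)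
    have hri : Qis X X (r.toFun ∘ₗ i.toFun) := retract_qis he
    have hric : Cm X X (r.toFun ∘ₗ i.toFun) := Cm.comp (N := Y) r.comm i.comm
    have q1 : Qis X' X ((r.toFun ∘ₗ i.toFun) ∘ₗ qX) := hri.comp hX3 hric hX2
    have n1 : Null X' X 0 ((r.toFun ∘ₗ i.toFun) ∘ₗ qX - qX ∘ₗ (v ∘ₗ u)) := by
      have m1 := hu3.comp_left rd r.comm (n' := 0) (by omega)
      have m2 := hv3.comp_right hu1 hu2 (n' := 0) (by omega)
      convert m1.add m2 using 1
      ext x; simp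
    have q2 := q1.of_null n1
    have hvu1 : Deg X' X' 0 (v ∘ₗ u) := hv1.comp hu1 (by omega)
    have hvu2 : Cm X' X' (v ∘ₗ u) := hv2.comp hu2
    have q3 : Qis X' X' (v ∘ₗ u) := hX3.of_comp q2 hX2 hvu2
    obtain ⟨w, hw1, hw2, hw3⟩ := hX.lift hvu1 hvu2 q3 (Deg.id (M := X')) Cm.id
    refine ⟨X', qX, ⟨hX, fun ι F => ?_⟩, hX1, hX2, hX3⟩
    exact Tst.retract (adm_cof F) (hY.2 ι F) (u ∘ₗ w) v (hu1.comp hw1 (by omega)) (hu2.comp hw2)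
      hv1 hv2 (null_symm hw3)

lemma hsm_of_fin (hA : IsDGAlgebra A 𝒜 dA) {K : DGMod A 𝒜 dA} (h : FinBuilds (aMod hA) K) :
    HSm K :=
  h HSm (thick_of_cl hA (hsm_cl hA)) ⟨aMod hA, LinearMap.id, sm_A hA, Deg.id, Cm.id,
    Qis.of_bij Function.bijective_id Cm.id⟩

end DGX
end

noncomputable section
namespace DGX
open DirectSum

lemma FinBuilds.shift {K T : DGMod A 𝒜 dA} (h : FinBuilds K T) (n : ℤ) : FinBuilds K (shift T n) :=
  fun P hP hK => (cl_of_thick hP).shift n (h P hP hK)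

lemma FinBuilds.ext {K M N : DGMod A 𝒜 dA} (hM : FinBuilds K M) (hN : FinBuilds K N)
    (τ : M.M →ₗ[A] N.M) (hd : Deg M N (-1) τ) (hc : Cm M N τ) : FinBuilds K (ext M N τ hd hc) :=
  fun P hP hK => (cl_of_thick hP).ext τ hd hc (hM P hP hK) (hN P hP hK)

/-- factorization of a map through an object finitely built by `K` -/
def FacM (K C X : DGMod A 𝒜 dA) (n : ℤ) (f : C.M →ₗ[A] X.M) : Prop :=
  ∃ (T : DGMod A 𝒜 dA) (g : C.M →ₗ[A] T.M) (h : T.M →ₗ[A] X.M), Sm T ∧ FinBuilds K T ∧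
    Deg C T 0 g ∧ Cm C T g ∧ Deg T X n h ∧ Cm T X h ∧ Null C X n (f - h ∘ₗ g)

/-- all maps from small objects factor -/
def Fac (K X : DGMod A 𝒜 dA) : Prop :=
  ∀ (C : DGMod A 𝒜 dA) (n : ℤ) (f : C.M →ₗ[A] X.M), Sm C → Deg C X n f → Cm C X f → FacM K C X n f

lemma FacM.of_null {K C X : DGMod A 𝒜 dA} {n : ℤ} {f f' : C.M →ₗ[A] X.M} (h : FacM K C X n f)
    (hn : Null C X n (f' - f)) : FacM K C X n f' := by
  obtain ⟨T, g, k, h1, h2, h3, h4, h5, h6, h7⟩ := h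
  refine ⟨T, g, k, h1, h2, h3, h4, h5, h6, ?_⟩
  have := hn.add h7
  rwa [sub_add_sub_cancel] at this

lemma FacM.comp {K C X Y : DGMod A 𝒜 dA} {n : ℤ} {f : C.M →ₗ[A] X.M} (h : FacM K C X n f)
    {u : X.M →ₗ[A] Y.M} (hu : Deg X Y 0 u) (huc : Cm X Y u) : FacM K C Y n (u ∘ₗ f) := by
  obtain ⟨T, g, k, h1, h2, h3, h4, h5, h6, h7⟩ := h
  refine ⟨T, g, u ∘ₗ k, h1, h2, h3, h4, hu.comp h5 (by omega), huc.comp h6, ?_⟩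
  have := h7.comp_left hu huc (n' := n) (by omega)
  rwa [LinearMap.comp_sub] at this

lemma FacM.of_comp {K C X Y : DGMod A 𝒜 dA} {n : ℤ} {f : C.M →ₗ[A] X.M} (hC : Kp C)
    (hf : Deg C X n f) (hfc : Cm C X f)
    {u : X.M →ₗ[A] Y.M} (hu : Deg X Y 0 u) (huc : Cm X Y u) (hq : Qis X Y u)
    (h : FacM K C Y n (u ∘ₗ f)) : FacM K C X n f := by
  obtain ⟨T, g, k, h1, h2, h3, h4, h5, h6, h7⟩ := h
  obtain ⟨k', a1, a2, a3⟩ := h1.1.lift hu huc hq h5 h6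
  refine ⟨T, g, k', h1, h2, h3, h4, a1, a2, ?_⟩
  refine hC.inj hu huc hq (hf.sub (a1.comp h3 (by omega))) (hfc.sub (a2.comp h4)) ?_
  have := h7.add (a3.comp_right h3 h4 (n' := n) (by omega))
  convert this using 1
  ext x; simp

lemma FacM.add {K C X : DGMod A 𝒜 dA} {n : ℤ} {f f' : C.M →ₗ[A] X.M} (h : FacM K C X n f)
    (h' : FacM K C X n f') : FacM K C X n (f + f') := by
  obtain ⟨T, g, k, h1, h2, h3, h4, h5, h6, h7⟩ := h
  obtain ⟨T', g', k', h1', h2', h3', h4', h5', h6', h7'⟩ := h'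
  have z1 : Deg T T' (-1) 0 := Deg.zero
  have z2 : Cm T T' 0 := Cm.zero
  refine ⟨ext T T' 0 z1 z2, g'.prod g, k'.coprod k, h1.ext h1' 0 z1 z2,
    FinBuilds.ext h2 h2' 0 z1 z2, prod_deg z1 z2 h3' h3, ?_, coprod_deg z1 z2 h5' h5, ?_, ?_⟩
  · intro m
    show (g' (C.d m), g (C.d m)) = (T'.d (g' m) + 0, T.d (g m))
    rw [h4, h4', add_zero]
  · rintro ⟨x, y⟩
    show k' (T'.d x + 0) + k (T.d y) = X.d (k' x + k y)
    rw [add_zero, h6, h6', map_add]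
  · convert h7.add h7' using 1
    ext x
    show f x + f' x - (k' (g' x) + k (g x)) = f x - k (g x) + (f' x - k' (g' x))
    abel

lemma FacM.neg {K C X : DGMod A 𝒜 dA} {n : ℤ} {f : C.M →ₗ[A] X.M} (h : FacM K C X n f) :
    FacM K C X n (-f) := by
  obtain ⟨T, g, k, h1, h2, h3, h4, h5, h6, h7⟩ := h
  refine ⟨T, g, -k, h1, h2, h3, h4, h5.neg, h6.neg, ?_⟩
  convert h7.neg using 1
  ext x; simp; abel

lemma fac_coprod {K : DGMod A 𝒜 dA} (hK : ∃ T, Sm T ∧ FinBuilds K T) {ι : Type}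
    (F : ι → DGMod A 𝒜 dA) (hF : ∀ i, Fac K (F i)) : Fac K (coprod F) := by
  intro C n f hC hf hfc
  obtain ⟨g, ⟨g1, g2, g3⟩, hg⟩ := hC.2 ι F n f hf hfc
  have key : ∀ φ ∈ IFin F, FacM K C (coprod F) n (φ ∘ₗ f) := by
    intro φ hφ
    refine AddSubgroup.closure_induction (p := fun φ _ => FacM K C (coprod F) n (φ ∘ₗ f))
      ?_ ?_ ?_ ?_ hφ
    · rintro φ ⟨i, c, h1, h2, rfl⟩
      exact (hF i C n (c ∘ₗ f) hC (h1.comp hf (by omega)) (h2.comp hfc)).comp (inc_deg F i)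
        (inc_cm F i)
    · obtain ⟨T, h1, h2⟩ := hK
      refine ⟨T, 0, 0, h1, h2, Deg.zero, Cm.zero, Deg.zero, Cm.zero, ?_⟩
      simpa using (Null.zero : Null C (coprod F) n 0)
    · intro a b _ _ ha hb
      rw [LinearMap.add_comp]; exact ha.add hb
    · intro a _ ha
      rw [LinearMap.neg_comp]; exact ha.neg
  refine (key _ g3).of_null ?_
  convert hg using 1
  ext x; simp

lemma desc_bij {ι : Type} {F : ι → DGMod A 𝒜 dA} {C : DGMod A 𝒜 dA} (φ : ∀ i, DGHom (F i) C)
    (h1 : ∀ i, Function.Injective (φ i).toFun)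
    (h2 : (⨆ i, LinearMap.range (φ i).toFun) = ⊤)
    (h3 : iSupIndep fun i => LinearMap.range (φ i).toFun) :
    Function.Bijective (desc F C (fun i => (φ i).toFun)) := by
  classical
  constructor
  · have h4 := h3.dfinsupp_lsum_injective
    have h5 : (fun x => desc F C (fun i => (φ i).toFun) x) = fun x =>
        DFinsupp.lsum ℕ (fun i => (LinearMap.range (φ i).toFun).subtype)
          (DFinsupp.mapRange.linearMap (fun i => (φ i).toFun.rangeRestrict) x) := by
      funext x
      refine cop_ext F (desc F C (fun i => (φ i).toFun)).toAddMonoidHom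
        ((DFinsupp.lsum ℕ (fun i => (LinearMap.range (φ i).toFun).subtype) ∘ₗ
          (DFinsupp.mapRange.linearMap (fun i => (φ i).toFun.rangeRestrict))).toAddMonoidHom) ?_ x
      intro i y
      refine (desc_inc F C (fun i => (φ i).toFun) i y).trans ?_
      simp [inc]
    show Function.Injective (fun x => desc F C (fun i => (φ i).toFun) x)
    rw [h5]
    refine h4.comp ?_
    rw [DFinsupp.mapRange.linearMap]
    refine (DFinsupp.mapRange_injective _ (fun i => map_zero _)).2 ?_
    intro i x y hxy
    exact h1 i (congrArg Subtype.val hxy)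
  · rw [← LinearMap.range_eq_top, eq_top_iff, ← h2]
    refine iSup_le fun i => ?_
    rintro _ ⟨y, rfl⟩
    exact ⟨inc F i y, desc_inc F C _ i y⟩

lemma isCoproduct_coprod {ι : Type} (F : ι → DGMod A 𝒜 dA) : IsCoproductOf F (coprod F) := by
  classical
  refine ⟨fun i => bun (inc F i) (inc_deg F i) (inc_cm F i), ?_, ?_, ?_⟩
  · intro i x y hxy
    have : prj F i (inc F i x) = prj F i (inc F i y) := congrArg _ hxy
    rwa [prj_inc_same, prj_inc_same] at this
  · rw [eq_top_iff]
    intro x _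
    induction x using cop_induction F with
    | h0 => exact zero_mem _
    | hi i x => exact Submodule.mem_iSup_of_mem i ⟨x, rfl⟩
    | ha x y hx hy => exact add_mem (hx trivial) (hy trivial)
  · intro i
    rw [Submodule.disjoint_def]
    rintro _ ⟨x, rfl⟩ hx
    have : (⨆ j, ⨆ (_ : j ≠ i), LinearMap.range (inc F j)) ≤ LinearMap.ker (prj F i) := by
      refine iSup_le fun j => iSup_le fun hj => ?_
      rintro _ ⟨y, rfl⟩
      show prj F i (inc F j y) = 0
      exact prj_inc_ne F j i hj y
    have h2 : prj F i (inc F i x) = 0 := this hx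
    rw [prj_inc_same] at h2
    show inc F i x = 0
    rw [h2, map_zero]

lemma fac_shift {K X : DGMod A 𝒜 dA} (h : Fac K X) (k : ℤ) : Fac K (shift X k) := by
  intro C n f hC hf hfc
  have e : ∀ (B : DGMod A 𝒜 dA) (n' : ℤ) (u : B.M →ₗ[A] X.M), Deg B (shift X k) n' u ↔
      Deg B X (n' - k) u := by
    intro B n' u
    refine forall_congr' fun i => forall_congr' fun m => imp_congr_right fun hm => ?_
    show u m ∈ X.ℳ (i + n' - k) ↔ u m ∈ X.ℳ (i + (n' - k))
    rw [add_sub_assoc]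
  obtain ⟨T, g, l, h1, h2, h3, h4, h5, h6, w, hw, ew⟩ := h C (n - k) f hC ((e _ _ _).1 hf) hfc
  exact ⟨T, g, l, h1, h2, h3, h4, (e _ _ _).2 h5, h6, w, (e _ _ _).2
    (by rwa [show n - k + 1 = n + 1 - k by ring] at hw), ew⟩

lemma fac_ext {K M N : DGMod A 𝒜 dA} (hM : Fac K M) (hN : Fac K N) (τ : M.M →ₗ[A] N.M)
    (hd : Deg M N (-1) τ) (hc : Cm M N τ) : Fac K (ext M N τ hd hc) := by
  intro C n φ hC hφ hφc
  obtain ⟨b, α0, hφe, hb, hα0, hbc, hα0c⟩ : ∃ (b : C.M →ₗ[A] M.M) (α0 : C.M →ₗ[A] N.M),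
      (∀ c, φ c = (α0 c, b c)) ∧ Deg C M n b ∧ Deg C N n α0 ∧ Cm C M b ∧
      ∀ c, α0 (C.d c) = N.d (α0 c) + τ (ε M (b c)) :=
    ⟨LinearMap.snd A N.M M.M ∘ₗ φ, LinearMap.fst A N.M M.M ∘ₗ φ, fun c => rfl,
      fun i c h => (hφ i c h).2, fun i c h => (hφ i c h).1, fun c => congrArg Prod.snd (hφc c),
      fun c => congrArg Prod.fst (hφc c)⟩
  obtain ⟨T, g, h, sT, fT, gd, gc, hdeg, hcm, k, kd, ek⟩ := hM C n b hC hb hbc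
  have ek' : ∀ c, M.d (k c) = b (ε C c) - h (g (ε C c)) + k (C.d c) := by
    intro c
    have := ek c
    rw [LinearMap.sub_apply, LinearMap.comp_apply] at this
    rw [this]; abel
  obtain ⟨α, αe, αd⟩ : ∃ α : C.M →ₗ[A] N.M, (∀ c, α c = α0 c + sgn n • τ (k c)) ∧ Deg C N n α :=
    ⟨α0 + sgn n • (τ ∘ₗ k), fun c => rfl, hα0.add ((hd.comp kd (by omega)).zsmul _)⟩
  have αc : ∀ c, α (C.d c) = N.d (α c) + sgn n • τ (h (g (ε C c))) := by
    intro c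
    rw [αe, αe, hα0c, map_add, map_zsmul, ← hc, ek', ε_f hb]
    simp only [map_add, map_sub, map_zsmul, smul_add, smul_sub]
    abel
  -- the map from the cone
  have hg1 : Deg (shift C 1) T (-1) g := deg_cone gd
  obtain ⟨θ, θe⟩ : ∃ θ : T.M × C.M →ₗ[A] N.M, ∀ t c, θ (t, c) = sgn n • τ (h t) + α c :=
    ⟨(sgn n • (τ ∘ₗ h)).coprod α, fun t c => rfl⟩
  have θd : Deg (cone g gd gc) N (n - 1) θ := by
    rintro i ⟨t, c⟩ ⟨h1, h2⟩
    have a1 := hd _ _ (hdeg _ _ h1)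
    have a2 := αd _ _ h2
    rw [show i + n + -1 = i + (n - 1) by ring] at a1
    rw [show i - 1 + n = i + (n - 1) by ring] at a2
    rw [θe]
    exact (N.ℳ (i + (n - 1))).add_mem (zsmul_mem a1 _) a2
  have θc : Cm (cone g gd gc) N θ := by
    rintro ⟨t, c⟩
    show θ (T.d t + g (ε (shift C 1) c), C.d c) = N.d (θ (t, c))
    rw [θe, θe, ε_shift_one, αc, map_add h, hcm, map_add N.d, map_zsmul, ← hc]
    simp only [map_neg, map_add, smul_add, smul_neg]
    abel
  obtain ⟨T', g', h', sT', fT', gd', gc', hd', hc', S, Sd, eS⟩ := hN (cone g gd gc) (n - 1) θ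
    (Sm.ext (hC.shift 1) sT g hg1 gc) θd θc
  obtain ⟨g1, eg1⟩ : ∃ g1 : T.M →ₗ[A] T'.M, ∀ t, g1 t = g' (t, 0) :=
    ⟨g' ∘ₗ LinearMap.inl A T.M C.M, fun t => rfl⟩
  obtain ⟨g2, eg2⟩ : ∃ g2 : C.M →ₗ[A] T'.M, ∀ t, g2 t = g' (0, t) :=
    ⟨g' ∘ₗ LinearMap.inr A T.M C.M, fun t => rfl⟩
  obtain ⟨S1, eS1⟩ : ∃ g1 : T.M →ₗ[A] N.M, ∀ t, g1 t = S (t, 0) :=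
    ⟨S ∘ₗ LinearMap.inl A T.M C.M, fun t => rfl⟩
  obtain ⟨S2, eS2⟩ : ∃ g1 : C.M →ₗ[A] N.M, ∀ t, g1 t = S (0, t) :=
    ⟨S ∘ₗ LinearMap.inr A T.M C.M, fun t => rfl⟩
  have Sadd : ∀ t c, S (t, c) = S1 t + S2 c := by
    intro t c
    rw [eS1, eS2, ← map_add]; simp
  have gadd : ∀ t c, g' (t, c) = g1 t + g2 c := by
    intro t c
    rw [eg1, eg2, ← map_add]; simp
  have S1d : ∀ i t, t ∈ T.ℳ i → S1 t ∈ N.ℳ (i + n) := by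
    intro i t ht
    have : S (t, 0) ∈ N.ℳ (i + (n - 1 + 1)) := Sd i (t, 0) ⟨ht, zero_mem _⟩
    rwa [sub_add_cancel, ← eS1] at this
  have S2d : ∀ i t, t ∈ C.ℳ i → S2 t ∈ N.ℳ (i + 1 + n) := by
    intro i t ht
    have : S (0, t) ∈ N.ℳ (i + 1 + (n - 1 + 1)) := Sd (i + 1) (0, t) ⟨zero_mem _, by
      show t ∈ C.ℳ (i + 1 - 1)
      rwa [add_sub_cancel_right]⟩
    rwa [sub_add_cancel, ← eS2] at this
  have g1d : ∀ i t, t ∈ T.ℳ i → g1 t ∈ T'.ℳ i := by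
    intro i t ht
    have : g' (t, 0) ∈ T'.ℳ (i + 0) := gd' i (t, 0) ⟨ht, zero_mem _⟩
    rwa [add_zero, ← eg1] at this
  have g2d : ∀ i t, t ∈ C.ℳ i → g2 t ∈ T'.ℳ (i + 1) := by
    intro i t ht
    have : g' (0, t) ∈ T'.ℳ (i + 1 + 0) := gd' (i + 1) (0, t) ⟨zero_mem _, by
      show t ∈ C.ℳ (i + 1 - 1)
      rwa [add_sub_cancel_right]⟩
    rwa [add_zero, ← eg2] at this
  have g1c : ∀ t, g1 (T.d t) = T'.d (g1 t) := by
    intro t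
    have : g' (T.d t + g (ε (shift C 1) 0), C.d 0) = T'.d (g' (t, 0)) := gc' (t, 0)
    rw [map_zero, map_zero, map_zero, add_zero] at this
    rw [eg1, eg1, this]
  have g2c : ∀ c, g2 (C.d c) = T'.d (g2 c) + g1 (g (ε C c)) := by
    intro c
    have : g' (T.d 0 + g (ε (shift C 1) c), C.d c) = T'.d (g' (0, c)) := gc' (0, c)
    rw [ε_shift_one, map_zero, zero_add, gadd, map_neg, map_neg, ← eg2] at this
    rw [← this]; abel
  have q1 : ∀ t, sgn n • τ (h (ε T t)) - h' (g1 (ε T t)) = N.d (S1 t) - S1 (T.d t) := by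
    intro t
    have := eS (t, 0)
    rw [ε_ext] at this
    have e2 : θ (ε T t, ε (shift C 1) 0) - h' (g' (ε T t, ε (shift C 1) 0)) =
      N.d (S (t, 0)) - S (T.d t + g (ε (shift C 1) 0), C.d 0) := this
    rw [map_zero, map_zero, map_zero, add_zero, θe, ← eg1, ← eS1, ← eS1, map_zero, add_zero] at e2
    exact e2
  have q2 : ∀ c, - α (ε C c) + h' (g2 (ε C c)) = N.d (S2 c) + S1 (g (ε C c)) - S2 (C.d c) := by
    intro c
    have := eS (0, c)
    rw [ε_ext] at this
    have e2 : θ (ε T 0, ε (shift C 1) c) - h' (g' (ε T 0, ε (shift C 1) c)) =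
      N.d (S (0, c)) - S (T.d 0 + g (ε (shift C 1) c), C.d c) := this
    rw [ε_shift_one, map_zero, map_zero, zero_add, θe, ← eg2, ← eS2, Sadd] at e2
    simp only [map_neg, map_zero, smul_zero, zero_add, sub_neg_eq_add] at e2
    rw [e2]; abel
  -- the new small object
  have Dd : Deg T (shift T' (-1)) (-1) g1 := by
    intro i t ht
    show g1 t ∈ T'.ℳ (i + -1 - -1)
    rw [show i + -1 - -1 = i by ring]
    exact g1d i t ht
  have ηγ : FacM K C (ext M N τ hd hc) n (α.prod (h ∘ₗ g)) := by
    refine ⟨ext T (shift T' (-1)) g1 Dd g1c, g2.prod g,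
      (h' ∘ₗ LinearMap.fst A T'.M T.M - S1 ∘ₗ LinearMap.snd A T'.M T.M).prod
        (h ∘ₗ LinearMap.snd A T'.M T.M), sT.ext (sT'.shift (-1)) g1 Dd g1c,
      FinBuilds.ext fT (FinBuilds.shift fT' (-1)) g1 Dd g1c, ?_, ?_, ?_, ?_, ?_⟩
    · intro i c hc0
      refine ⟨?_, gd i c hc0⟩
      show g2 c ∈ T'.ℳ (i + 0 - -1)
      rw [show i + 0 - -1 = i + 1 by ring]
      exact g2d i c hc0
    · intro c
      show (g2 (C.d c), g (C.d c)) = (T'.d (g2 c) + g1 (ε T (g c)), T.d (g c))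
      rw [g2c, gc, ε_f0 gd]
    · rintro i ⟨t', t⟩ ⟨h1, h2⟩
      refine ⟨?_, hdeg i t h2⟩
      have h3 : h' t' ∈ N.ℳ (i - -1 + (n - 1)) := hd' _ _ h1
      rw [show i - -1 + (n - 1) = i + n by ring] at h3
      exact (N.ℳ (i + n)).sub_mem h3 (S1d _ _ h2)
    · rintro ⟨t', t⟩
      show (h' (T'.d t' + g1 (ε T t)) - S1 (T.d t), h (T.d t)) =
        (N.d (h' t' - S1 t) + τ (ε M (h t)), M.d (h t))
      rw [hcm]
      refine Prod.ext ?_ rfl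
      show h' (T'.d t' + g1 (ε T t)) - S1 (T.d t) = N.d (h' t' - S1 t) + τ (ε M (h t))
      have := q1 t
      rw [ε_f hdeg, map_add, map_sub, hc', map_zsmul, sub_eq_iff_eq_add.1 this]
      abel
    · refine ⟨(-S2).prod 0, ?_, ?_⟩
      · intro i c hc0
        refine ⟨?_, zero_mem _⟩
        have := S2d i c hc0
        rw [show i + 1 + n = i + (n + 1) by ring] at this
        exact (N.ℳ (i + (n + 1))).neg_mem this
      · intro c
        show (α (ε C c) - (h' (g2 (ε C c)) - S1 (g (ε C c))), h (g (ε C c)) - h (g (ε C c))) =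
          (N.d (- S2 c) + τ (ε M 0) - - S2 (C.d c), M.d 0 - 0)
        refine Prod.ext ?_ (by simp)
        show α (ε C c) - (h' (g2 (ε C c)) - S1 (g (ε C c))) =
          N.d (- S2 c) + τ (ε M 0) - - S2 (C.d c)
        have := q2 c
        rw [neg_add_eq_iff_eq_add] at this
        rw [this, map_neg, map_zero, map_zero]; abel
  refine ηγ.of_null ⟨LinearMap.prod 0 k, ?_, ?_⟩
  · intro i c hc0
    exact ⟨zero_mem _, kd i c hc0⟩
  · intro c
    rw [LinearMap.sub_apply, hφe]
    show (α0 (ε C c) - α (ε C c), b (ε C c) - h (g (ε C c))) =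
      (N.d 0 + τ (ε M (k c)) - 0, M.d (k c) - k (C.d c))
    refine Prod.ext ?_ (ek c)
    show α0 (ε C c) - α (ε C c) = N.d 0 + τ (ε M (k c)) - 0
    rw [αe, ε_f kd, map_zero, sgn_add_one]
    simp

lemma fac_cl {K : DGMod A 𝒜 dA} : Cl (Fac K) where
  qis := by
    intro M N f hf hfc hq
    constructor
    · intro hM C n u hC hu huc
      obtain ⟨u', a1, a2, a3⟩ := hC.1.lift hf hfc hq hu huc
      exact ((hM C n u' hC a1 a2).comp hf hfc).of_null a3
    · intro hN C n u hC hu huc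
      exact (hN C n (f ∘ₗ u) hC (hf.comp hu (by omega)) (hfc.comp huc)).of_comp hC.1 hu huc hf hfc hq
  shift := fun n h => fac_shift h n
  ext := fun τ hd hc h1 h2 => fac_ext h1 h2 τ hd hc
  retract := by
    rintro X Y ⟨i, r, h, hh, he⟩ hY C n u hC hu huc
    have id1 := deg_of _ _ i
    have rd := deg_of _ _ r
    have hri : Qis X X (r.toFun ∘ₗ i.toFun) := retract_qis he
    have hric : Cm X X (r.toFun ∘ₗ i.toFun) := Cm.comp (N := Y) r.comm i.comm
    refine FacM.of_comp hC.1 hu huc (rd.comp id1 (by omega)) hric hri ?_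
    have := (hY C n (i.toFun ∘ₗ u) hC (id1.comp hu (by omega))
      (Cm.comp (L := Y) i.comm huc)).comp rd r.comm
    exact this

lemma fac_loc (hA : IsDGAlgebra A 𝒜 dA) {K : DGMod A 𝒜 dA} (hK : ∃ T, Sm T ∧ FinBuilds K T) :
    IsLocalizingClass (Fac K) where
  toIsThickClass := thick_of_cl hA fac_cl
  coprod := by
    rintro ι F C ⟨φ, h1, h2, h3⟩ hF
    have hc := desc_cm F C (fun i => (φ i).toFun) (fun i => (φ i).comm)
    exact (fac_cl.qis (desc F C (fun i => (φ i).toFun))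
      (desc_deg F C 0 _ (fun i => deg_of _ _ (φ i))) hc
      (Qis.of_bij (desc_bij φ h1 h2 h3) hc)).1 (fac_coprod hK F hF)

lemma fin_of_build (hA : IsDGAlgebra A 𝒜 dA) {K : DGMod A 𝒜 dA} (hK : FinBuilds (aMod hA) K)
    (hb : Builds K (aMod hA)) : FinBuilds K (aMod hA) := by
  obtain ⟨K', q, h1, h2, h3, h4⟩ := hsm_of_fin hA hK
  have h5 : FinBuilds K K' := fun P hP hK => ((cl_of_thick hP).qis q h2 h3 h4).2 hK
  have hKK : Fac K K := by
    intro C n f hC hf hfc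
    obtain ⟨f', a1, a2, a3⟩ := hC.1.lift h2 h3 h4 hf hfc
    refine ⟨shift K' (-n), f', q, h1.shift _, FinBuilds.shift h5 _, ?_, a2, ?_, h3, a3⟩
    · intro i c hc
      show f' c ∈ K'.ℳ (i + 0 - -n)
      rw [show i + 0 - -n = i + n by ring]
      exact a1 i c hc
    · intro i c hc
      have := h2 _ _ hc
      rwa [show i - -n + 0 = i + n by ring] at this
  obtain ⟨T, g, h, b1, b2, b3, b4, b5, b6, k, b7, b8⟩ := hb _ (fac_loc hA ⟨K', h1, h5⟩) hKK (aMod hA) 0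
    LinearMap.id (sm_A hA) Deg.id Cm.id
  intro P hP hPK
  refine hP.retract (X := T) ⟨bun g b3 b4, bun h b5 b6,
    -(k.toAddMonoidHom.comp (ε (aMod hA))), ?_, ?_⟩ (b2 P hP hPK)
  · intro j m hm
    have := b7 j _ (ε_mem_iff (aMod hA) hm)
    rw [zero_add] at this
    exact ((aMod hA).ℳ (j + 1)).neg_mem this
  · intro m
    show h (g m) - m = (aMod hA).d (- k (ε (aMod hA) m)) + - k (ε (aMod hA) ((aMod hA).d m))
    have := b8 (ε (aMod hA) m)
    rw [ε_ε, ε_cyc, map_neg, LinearMap.sub_apply] at this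
    have h2 : m - h (g m) = (aMod hA).d (k (ε (aMod hA) m)) - - k (ε (aMod hA) ((aMod hA).d m)) := this
    rw [← neg_sub m, h2, map_neg]; abel

end DGX
end

noncomputable section
namespace DGX
open DirectSum

lemma p_smul (M : DGMod A 𝒜 dA) {j : ℤ} {a : A} (ha : a ∈ 𝒜 j) (i : ℤ) (x : M.M) :
    p M i (a • x) = a • p M (i - j) x := by
  refine gr_ext M.internal ((p M i).comp (DistribMulAction.toAddMonoidHom M.M a))
    ((DistribMulAction.toAddMonoidHom M.M a).comp (p M (i - j))) ?_ x
  intro l m hm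
  show p M i (a • m) = a • p M (i - j) m
  by_cases h : l = i - j
  · subst h
    have h1 := M.smul_mem ha hm
    rw [show j + (i - j) = i by ring] at h1
    rw [p, p, gp_same _ h1, gp_same _ hm]
  · have h1 := M.smul_mem ha hm
    rw [p, p, gp_ne _ h1 (by omega), gp_ne _ hm h, smul_zero]

lemma p_p_ne (M : DGMod A 𝒜 dA) {i j : ℤ} (h : i ≠ j) (x : M.M) : p M j (p M i x) = 0 :=
  gp_ne _ (gp_mem _ i x) h

lemma p_p_same (M : DGMod A 𝒜 dA) (i : ℤ) (x : M.M) : p M i (p M i x) = p M i x :=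
  gp_same _ (gp_mem _ i x)

/-- sub dg module -/
@[reducible] def subD (M : DGMod A 𝒜 dA) (L : Submodule A M.M) (hp : ∀ i, ∀ x ∈ L, p M i x ∈ L)
    (hd : ∀ x ∈ L, M.d x ∈ L) : DGMod A 𝒜 dA where
  M := L
  ℳ i := (M.ℳ i).comap L.subtype.toAddMonoidHom
  d := (M.d.comp L.subtype.toAddMonoidHom).codRestrict L (fun x => hd x.1 x.2)
  internal := by
    refine internal_of _ (fun i => ((p M i).comp L.subtype.toAddMonoidHom).codRestrict L
      (fun x => hp i x.1 x.2)) ?_ ?_ ?_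
    · intro i x hx
      exact Subtype.ext (gp_same _ hx)
    · intro i j x hx hij
      exact Subtype.ext (gp_ne _ hx hij)
    · intro x
      obtain ⟨s, hs⟩ := gr_sum M.internal x.1
      have : x = ∑ i ∈ s, (⟨p M i x.1, hp i x.1 x.2⟩ : L) := by
        apply Subtype.ext
        rw [AddSubmonoidClass.coe_finset_sum]
        exact hs s le_rfl
      rw [this]
      refine sum_mem fun i _ => AddSubgroup.mem_iSup_of_mem i ?_
      exact gp_mem M.internal i x.1
  smul_mem := fun ha hm => M.smul_mem ha hm
  d_mem := fun hm => M.d_mem hm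
  d_sq := fun m => Subtype.ext (M.d_sq m.1)
  leibniz := fun a m ha => Subtype.ext (M.leibniz a m.1 ha)

lemma sub_deg (M : DGMod A 𝒜 dA) (L : Submodule A M.M) (hp : ∀ i, ∀ x ∈ L, p M i x ∈ L)
    (hd : ∀ x ∈ L, M.d x ∈ L) : Deg (subD M L hp hd) M 0 L.subtype := by
  intro i x hx
  rw [add_zero]; exact hx

lemma sub_cm (M : DGMod A 𝒜 dA) (L : Submodule A M.M) (hp : ∀ i, ∀ x ∈ L, p M i x ∈ L)
    (hd : ∀ x ∈ L, M.d x ∈ L) : Cm (subD M L hp hd) M L.subtype := fun _ => rfl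

section post
variable (hA : IsDGAlgebra A 𝒜 dA) (hn : ∀ i : ℤ, i < 0 → 𝒜 i = ⊥) (M : DGMod A 𝒜 dA)

/-- vanishing below `k` -/
def U (k : ℤ) : AddSubgroup M.M where
  carrier := {x | ∀ i < k, p M i x = 0}
  add_mem' := fun hx hy i hi => by rw [map_add, hx i hi, hy i hi, add_zero]
  zero_mem' := fun i _ => map_zero _
  neg_mem' := fun hx i hi => by rw [map_neg, hx i hi, neg_zero]

variable {M}

lemma U_mono {k l : ℤ} (h : k ≤ l) {x : M.M} (hx : x ∈ U M l) : x ∈ U M k :=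
  fun i hi => hx i (by omega)

lemma U_hom {k i : ℤ} {x : M.M} (hx : x ∈ M.ℳ i) (h : k ≤ i) : x ∈ U M k :=
  fun j hj => gp_ne _ hx (by omega)

lemma U_p {k : ℤ} {x : M.M} (hx : x ∈ U M k) (i : ℤ) : p M i x ∈ U M k := by
  intro j hj
  by_cases h : i = j
  · subst h; rw [p_p_same]; exact hx _ hj
  · exact p_p_ne M h x

lemma U_d {k : ℤ} {x : M.M} (hx : x ∈ U M (k + 1)) : M.d x ∈ U M k := by
  intro i hi
  rw [p_d, hx _ (by omega), map_zero]

lemma U_smul_hom (hn : ∀ i : ℤ, i < 0 → 𝒜 i = ⊥) {k j : ℤ} {a : A} (ha : a ∈ 𝒜 j) {x : M.M}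
    (hx : x ∈ U M k) : a • x ∈ U M (k + j) := by
  intro i hi
  rw [p_smul M ha, hx _ (by omega), smul_zero]

lemma U_smul (hA : IsDGAlgebra A 𝒜 dA) (hn : ∀ i : ℤ, i < 0 → 𝒜 i = ⊥) {k : ℤ} (a : A) {x : M.M}
    (hx : x ∈ U M k) : a • x ∈ U M k := by
  induction a using gr_induction hA.internal with
  | hh j a ha =>
    by_cases hj : j < 0
    · rw [hn j hj] at ha
      rw [AddSubgroup.mem_bot.1 ha, zero_smul]; exact zero_mem _
    · exact U_mono (by omega) (U_smul_hom hn ha hx)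
  | ha a b h1 h2 => rw [add_smul]; exact add_mem h1 h2

variable (M) in
/-- cycles in degree `k`, everything above -/
def L (hA : IsDGAlgebra A 𝒜 dA) (hn : ∀ i : ℤ, i < 0 → 𝒜 i = ⊥) (k : ℤ) : Submodule A M.M where
  carrier := {x | x ∈ U M k ∧ M.d x ∈ U M k}
  add_mem' := fun hx hy => ⟨add_mem hx.1 hy.1, by rw [map_add]; exact add_mem hx.2 hy.2⟩
  zero_mem' := ⟨zero_mem _, by rw [map_zero]; exact zero_mem _⟩
  smul_mem' := by
    rintro a x ⟨h1, h2⟩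
    refine ⟨U_smul hA hn a h1, ?_⟩
    induction a using gr_induction hA.internal with
    | hh j a ha =>
      rw [leib M a x ha]
      exact add_mem (U_smul hA hn _ h1) (zsmul_mem (U_smul hA hn _ h2) _)
    | ha a b h1 h2 => rw [add_smul, map_add]; exact add_mem h1 h2

variable (M) in
/-- everything above `k` and its boundaries -/
def J (hA : IsDGAlgebra A 𝒜 dA) (hn : ∀ i : ℤ, i < 0 → 𝒜 i = ⊥) (k : ℤ) : Submodule A M.M where
  carrier := {x | ∃ u ∈ U M (k + 1), ∃ v ∈ U M (k + 1), x = u + M.d v}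
  add_mem' := by
    rintro _ _ ⟨u, hu, v, hv, rfl⟩ ⟨u', hu', v', hv', rfl⟩
    exact ⟨u + u', add_mem hu hu', v + v', add_mem hv hv', by rw [map_add]; abel⟩
  zero_mem' := ⟨0, zero_mem _, 0, zero_mem _, by simp⟩
  smul_mem' := by
    rintro a _ ⟨u, hu, v, hv, rfl⟩
    induction a using gr_induction hA.internal with
    | hh j a ha =>
      refine ⟨a • u - sgn j • (dA a • v), sub_mem (U_smul hA hn a hu)
        (zsmul_mem (U_smul hA hn _ hv) _), sgn j • (a • v), zsmul_mem (U_smul hA hn _ hv) _, ?_⟩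
      rw [map_zsmul, leib M a v ha, smul_add, smul_add (sgn j), smul_smul (sgn j) (sgn j), sgn_mul_self, one_smul]
      abel
    | ha a b h1 h2 =>
      obtain ⟨u1, hu1, v1, hv1, e1⟩ := h1
      obtain ⟨u2, hu2, v2, hv2, e2⟩ := h2
      exact ⟨u1 + u2, add_mem hu1 hu2, v1 + v2, add_mem hv1 hv2, by
        rw [add_smul, e1, e2, map_add]; abel⟩

lemma U_le_J {k : ℤ} {x : M.M} (hx : x ∈ U M (k + 1)) : x ∈ J M hA hn k :=
  ⟨x, hx, 0, zero_mem _, by simp⟩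

lemma dU_le_J {k : ℤ} {x : M.M} (hx : x ∈ U M (k + 1)) : M.d x ∈ J M hA hn k :=
  ⟨0, zero_mem _, x, hx, by simp⟩

lemma L_p (k : ℤ) (i : ℤ) (x : M.M) (hx : x ∈ L M hA hn k) : p M i x ∈ L M hA hn k := by
  refine ⟨U_p hx.1 i, ?_⟩
  have := p_d M (i - 1) x
  rw [sub_add_cancel] at this
  rw [← this]
  exact U_p hx.2 _

lemma L_d (k : ℤ) (x : M.M) (hx : x ∈ L M hA hn k) : M.d x ∈ L M hA hn k :=
  ⟨hx.2, by rw [M.d_sq]; exact zero_mem _⟩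

lemma L_cyc {k : ℤ} {x : M.M} (hx : x ∈ L M hA hn k) : M.d (p M k x) = 0 := by
  have := p_d M (k - 1) x
  rw [sub_add_cancel] at this
  rw [← this]
  exact hx.2 _ (by omega)

lemma U_split {k : ℤ} {x : M.M} (hx : x ∈ U M k) : x - p M k x ∈ U M (k + 1) := by
  intro i hi
  rw [map_sub]
  by_cases h : k = i
  · subst h; rw [p_p_same, sub_self]
  · rw [p_p_ne M h, hx i (by omega), sub_zero]

lemma L_dJ {k : ℤ} {x : M.M} (hx : x ∈ L M hA hn k) : M.d x ∈ J M hA hn k := by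
  have := dU_le_J hA hn (U_split hx.1)
  rwa [map_sub, L_cyc hA hn hx, sub_zero] at this

variable (M) in
/-- truncation as dg module -/
@[reducible] def LD (k : ℤ) : DGMod A 𝒜 dA := subD M (L M hA hn k) (L_p hA hn k) (L_d hA hn k)

lemma smul_LJ {k j : ℤ} {a : A} (ha : a ∈ 𝒜 j) (hj : j ≠ 0) {x : M.M} (hx : x ∈ L M hA hn k) :
    a • x ∈ J M hA hn k := by
  by_cases h : j < 0
  · rw [hn j h] at ha
    rw [AddSubgroup.mem_bot.1 ha, zero_smul]; exact zero_mem _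
  · exact U_le_J hA hn (U_mono (by omega) (U_smul_hom hn ha hx.1))

lemma d_smul_LJ {k j : ℤ} {a : A} (ha : a ∈ 𝒜 j) {x : M.M} (hx : x ∈ L M hA hn k) :
    dA a • x ∈ J M hA hn k := by
  by_cases h : j < 1
  · exact smul_LJ hA hn (hA.d_mem ha) (by omega) hx
  · have e : dA a • x = - (sgn j • (a • M.d x)) + M.d (a • x) := by rw [leib M a x ha]; abel
    exact ⟨_, neg_mem (zsmul_mem (U_mono (by omega) (U_smul_hom hn ha hx.2)) _), _,
      U_mono (by omega) (U_smul_hom hn ha hx.1), e⟩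

variable (M) in
/-- kernel -/
abbrev JL (k : ℤ) : Submodule A (L M hA hn k) := (J M hA hn k).comap (L M hA hn k).subtype

variable (M) in
/-- homology module in degree `k` -/
@[reducible] def HD (k : ℤ) : DGMod A 𝒜 dA where
  M := L M hA hn k ⧸ JL hA hn M k
  ℳ i := if i = k then ⊤ else ⊥
  d := 0
  internal := by
    refine internal_of _ (fun i => if i = k then AddMonoidHom.id _ else 0) ?_ ?_ ?_
    · intro i x hx
      by_cases h : i = k
      · simp [h]
      · rw [if_neg h] at hx
        rw [AddSubgroup.mem_bot.1 hx, map_zero]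
    · intro i j x hx hij
      by_cases h : j = k
      · rw [if_neg (by omega)] at hx
        rw [AddSubgroup.mem_bot.1 hx, map_zero]
      · rw [if_neg h]; rfl
    · intro x
      refine AddSubgroup.mem_iSup_of_mem k ?_
      rw [if_pos rfl]; trivial
  smul_mem := by
    intro i j a m ha hm
    by_cases h : j = k
    · by_cases hi : i = 0
      · rw [if_pos (by omega)]; trivial
      · obtain ⟨x, rfl⟩ := Submodule.mkQ_surjective _ m
        rw [← map_smul, Submodule.mkQ_apply, (Submodule.Quotient.mk_eq_zero _).2]
        · exact zero_mem _
        · exact smul_LJ hA hn ha hi x.2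
    · rw [if_neg h] at hm
      rw [AddSubgroup.mem_bot.1 hm, smul_zero]; exact zero_mem _
  d_mem := fun _ => zero_mem _
  d_sq := fun _ => rfl
  leibniz := by
    intro i a m ha
    obtain ⟨x, rfl⟩ := Submodule.mkQ_surjective _ m
    have : dA a • (JL hA hn M k).mkQ x = 0 := by
      rw [← map_smul, Submodule.mkQ_apply, (Submodule.Quotient.mk_eq_zero _).2]
      exact d_smul_LJ hA hn ha x.2
    rw [this]; simp

lemma hd_kil {Z : DGMod A 𝒜 dA} (hZ : IsHZero hA Z) : ∃ u : Z.M, IsGen Z u ∧ Kil Z u Z ∧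
    ∀ k, Kil Z u (HD hA hn M k) := by
  obtain ⟨h1, h2, π, h3, h4⟩ := hZ
  have hπ : ∀ a : A, a • π.toFun (oneA hA) = π.toFun (show (aMod hA).M from a) := by
    intro a
    rw [← map_smul]
    congr 1
    exact mul_one (a : A)
  have pos : ∀ (i : ℤ) (a : A), a ∈ 𝒜 i → i ≠ 0 → π.toFun (show (aMod hA).M from a) = 0 := by
    intro i a ha hi
    have : π.toFun (show (aMod hA).M from a) ∈ Z.ℳ i := π.mem ha
    rw [h1 i hi] at this
    exact AddSubgroup.mem_bot.1 this
  -- decompose an element of the annihilator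
  have dec : ∀ a : A, ∃ b c : A, a = b + c ∧ b ∈ 𝒜 0 ∧ c ∈ AddSubgroup.closure
      {c : A | ∃ i : ℤ, i ≠ 0 ∧ c ∈ 𝒜 i} := by
    intro a
    induction a using gr_induction hA.internal with
    | hh j a ha =>
      by_cases hj : j = 0
      · subst hj
        exact ⟨a, 0, by simp, ha, zero_mem _⟩
      · exact ⟨0, a, by simp, zero_mem _, AddSubgroup.subset_closure ⟨j, hj, ha⟩⟩
    | ha a b h1 h2 =>
      obtain ⟨b1, c1, rfl, e1, f1⟩ := h1
      obtain ⟨b2, c2, rfl, e2, f2⟩ := h2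
      exact ⟨b1 + b2, c1 + c2, by abel, add_mem e1 e2, add_mem f1 f2⟩
  have ann : ∀ (W : Type) [AddCommGroup W] [Module A W],
      (∀ (i : ℤ) (a : A), a ∈ 𝒜 i → i ≠ 0 → ∀ x : W, a • x = 0) →
      (∀ a ∈ 𝒜 1, ∀ x : W, dA a • x = 0) →
      ∀ a : A, a • π.toFun (oneA hA) = 0 → ∀ x : W, a • x = 0 := by
    intro W _ _ w1 w2 a ha x
    obtain ⟨b, c, rfl, hb, hc⟩ := dec a
    have c1 : ∀ (W' : Type) [AddCommGroup W'] [Module A W'],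
        (∀ (i : ℤ) (a : A), a ∈ 𝒜 i → i ≠ 0 → ∀ x : W', a • x = 0) → ∀ x : W', c • x = 0 := by
      intro W' _ _ w x
      refine AddSubgroup.closure_induction (p := fun c _ => c • x = 0) ?_ ?_ ?_ ?_ hc
      · rintro c ⟨i, hi, hci⟩
        exact w i c hci hi x
      · exact zero_smul _ _
      · intro a b _ _ ha hb
        rw [add_smul, ha, hb, add_zero]
      · intro a _ ha
        rw [neg_smul, ha, neg_zero]
    have pZ : ∀ (i : ℤ) (a : A), a ∈ 𝒜 i → i ≠ 0 → ∀ x : Z.M, a • x = 0 := by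
      intro i a ha hi x
      induction x using gr_induction Z.internal with
      | hh j m hm =>
        by_cases hj : j = 0
        · subst hj
          have := Z.smul_mem ha hm
          rw [add_zero, h1 i hi] at this
          exact AddSubgroup.mem_bot.1 this
        · rw [h1 j hj] at hm
          rw [AddSubgroup.mem_bot.1 hm, smul_zero]
      | ha x y hx hy => rw [smul_add, hx, hy, add_zero]
    rw [add_smul, c1 Z.M pZ, add_zero, hπ] at ha
    obtain ⟨y, hy, rfl⟩ := (h4 b hb).1 ha
    rw [add_smul, w2 y hy, c1 W w1, add_zero]
  refine ⟨π.toFun (oneA hA), ⟨π.mem hA.one_mem, by rw [h2]; rfl, ?_⟩, ?_, ?_⟩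
  · intro z
    obtain ⟨a, rfl⟩ := h3 z
    exact ⟨a, hπ a⟩
  · refine ann Z.M ?_ ?_
    · intro i a ha hi x
      induction x using gr_induction Z.internal with
      | hh j m hm =>
        by_cases hj : j = 0
        · subst hj
          have := Z.smul_mem ha hm
          rw [add_zero, h1 i hi] at this
          exact AddSubgroup.mem_bot.1 this
        · rw [h1 j hj] at hm
          rw [AddSubgroup.mem_bot.1 hm, smul_zero]
      | ha x y hx hy => rw [smul_add, hx, hy, add_zero]
    · intro a ha x
      have := Z.leibniz a x ha
      rw [h2] at this
      simpa using this.symm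
  · intro k
    refine ann (L M hA hn k ⧸ JL hA hn M k) ?_ ?_
    · intro i a ha hi m
      obtain ⟨x, rfl⟩ := Submodule.mkQ_surjective _ m
      rw [← map_smul, Submodule.mkQ_apply, (Submodule.Quotient.mk_eq_zero _).2]
      exact smul_LJ hA hn ha hi x.2
    · intro a ha m
      obtain ⟨x, rfl⟩ := Submodule.mkQ_surjective _ m
      rw [← map_smul, Submodule.mkQ_apply, (Submodule.Quotient.mk_eq_zero _).2]
      exact d_smul_LJ hA hn ha x.2

lemma L_mono {k : ℤ} : L M hA hn (k + 1) ≤ L M hA hn k :=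
  fun _ hx => ⟨U_mono (by omega) hx.1, U_mono (by omega) hx.2⟩

variable (M) in
/-- inclusion of truncations -/
abbrev incL (k : ℤ) : (LD hA hn M (k + 1)).M →ₗ[A] (LD hA hn M k).M :=
  Submodule.inclusion (L_mono hA hn)

lemma incL_deg (k : ℤ) : Deg (LD hA hn M (k + 1)) (LD hA hn M k) 0 (incL hA hn M k) := by
  intro i x hx
  rw [add_zero]; exact hx

lemma incL_cm (k : ℤ) : Cm (LD hA hn M (k + 1)) (LD hA hn M k) (incL hA hn M k) := fun _ => rfl

variable (M) in
/-- cone of the inclusion -/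
abbrev CL (k : ℤ) : DGMod A 𝒜 dA := cone (M := LD hA hn M (k + 1)) (N := LD hA hn M k)
  (incL hA hn M k) (incL_deg hA hn k) (incL_cm hA hn k)

variable (M) in
/-- projection to homology -/
def prH (k : ℤ) : (CL hA hn M k).M →ₗ[A] (HD hA hn M k).M :=
  (JL hA hn M k).mkQ ∘ₗ LinearMap.fst A (L M hA hn k) (L M hA hn (k + 1))

lemma prH_apply (k : ℤ) (y : L M hA hn k) (x : L M hA hn (k + 1)) :
    prH hA hn M k (y, x) = (JL hA hn M k).mkQ y := rfl

lemma mkQ_zero {k : ℤ} {y : L M hA hn k} : (JL hA hn M k).mkQ y = 0 ↔ y.1 ∈ J M hA hn k := by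
  rw [Submodule.mkQ_apply, Submodule.Quotient.mk_eq_zero]; rfl

lemma prH_deg (k : ℤ) : Deg (CL hA hn M k) (HD hA hn M k) 0 (prH hA hn M k) := by
  rintro i ⟨y, x⟩ ⟨h1, h2⟩
  have h1 : y.1 ∈ M.ℳ i := h1
  rw [prH_apply, add_zero]
  show _ ∈ (if i = k then (⊤ : AddSubgroup _) else ⊥)
  by_cases h : i = k
  · rw [if_pos h]; trivial
  · rw [if_neg h, AddSubgroup.mem_bot, mkQ_zero]
    by_cases h' : i < k
    · have := y.2.1 i h'
      rw [p, gp_same _ h1] at this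
      rw [this]; exact zero_mem _
    · exact U_le_J hA hn (U_hom h1 (by omega))

lemma prH_cm (k : ℤ) : Cm (CL hA hn M k) (HD hA hn M k) (prH hA hn M k) := by
  rintro ⟨y, x⟩
  show (JL hA hn M k).mkQ ((LD hA hn M k).d y + incL hA hn M k (ε (shift (LD hA hn M (k + 1)) 1) x)) = 0
  rw [mkQ_zero]
  exact add_mem (L_dJ hA hn y.2) (U_le_J hA hn
    (show L M hA hn (k + 1) from ε (shift (LD hA hn M (k + 1)) 1) x).2.1)

lemma prH_qis (k : ℤ) : Qis (CL hA hn M k) (HD hA hn M k) (prH hA hn M k) := by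
  constructor
  · intro z _
    obtain ⟨y, rfl⟩ := Submodule.mkQ_surjective _ z
    refine ⟨(⟨p M k y.1, L_p hA hn k k y.1 y.2⟩, 0), 0, ?_, ?_⟩
    · refine Prod.ext ?_ (map_zero (shift (LD hA hn M (k + 1)) 1).d)
      show (LD hA hn M k).d _ + incL hA hn M k (ε (shift (LD hA hn M (k + 1)) 1) 0) = 0
      rw [map_zero, map_zero, add_zero]
      exact Subtype.ext (L_cyc hA hn y.2)
    · rw [map_zero, add_zero, prH_apply, ← sub_eq_zero, ← map_sub, mkQ_zero, ← neg_mem_iff]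
      have := U_le_J hA hn (U_split y.2.1)
      show -(p M k y.1 - y.1) ∈ _
      rwa [neg_sub]
  · rintro ⟨y, x⟩ hz ⟨w, hw⟩
    have hw : (JL hA hn M k).mkQ y = 0 := hw
    rw [mkQ_zero] at hw
    obtain ⟨u, hu, v, hv, e⟩ := hw
    have z1 : (LD hA hn M k).d y + incL hA hn M k (ε (shift (LD hA hn M (k + 1)) 1) x) = 0 :=
      congrArg Prod.fst hz
    have z2 : (LD hA hn M (k + 1)).d x = 0 := congrArg Prod.snd hz
    have ε1 : ∀ x : L M hA hn (k + 1), (ε (LD hA hn M (k + 1)) x).1 = ε M x.1 := fun x =>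
      (ε_f0 (sub_deg M _ (L_p hA hn (k + 1)) (L_d hA hn (k + 1))) x).symm
    rw [ε_shift_one, map_neg, add_neg_eq_zero] at z1
    have z3 : M.d y.1 = ε M x.1 := (congrArg Subtype.val z1).trans (ε1 x)
    have z4 : M.d u = ε M x.1 := by rw [← z3, e, map_add, M.d_sq, add_zero]
    have uL : u ∈ L M hA hn (k + 1) := ⟨hu, by
      rw [z4, ← ε1]; exact (show L M hA hn (k + 1) from ε (LD hA hn M (k + 1)) x).2.1⟩
    have vL : v ∈ L M hA hn k := ⟨U_mono (by omega) hv, U_d hv⟩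
    refine ⟨(⟨v, vL⟩, - ε (LD hA hn M (k + 1)) ⟨u, uL⟩), ?_⟩
    refine Prod.ext ?_ ?_
    · show y = (LD hA hn M k).d ⟨v, vL⟩ + incL hA hn M k (ε (shift (LD hA hn M (k + 1)) 1)
        (- ε (LD hA hn M (k + 1)) ⟨u, uL⟩))
      rw [ε_shift_one, map_neg (ε (LD hA hn M (k + 1))), neg_neg, ε_ε]
      apply Subtype.ext
      show y.1 = M.d v + u
      rw [e, add_comm]
    · show x = (LD hA hn M (k + 1)).d (- ε (LD hA hn M (k + 1)) ⟨u, uL⟩)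
      rw [map_neg, ε_cyc, neg_neg]
      apply Subtype.ext
      rw [ε1]
      show x.1 = ε M (M.d u)
      rw [z4, ε_ε]

lemma clr_loc {P : DGMod A 𝒜 dA → Prop} (hP : IsLocalizingClass P) : ClR P where
  shift := (cl_of_thick hP.toIsThickClass).shift
  ext := (cl_of_thick hP.toIsThickClass).ext
  coprod := fun F h => hP.coprod F _ (isCoproduct_coprod F) h

lemma loc_acyc {P : DGMod A 𝒜 dA → Prop} (hP : IsLocalizingClass P) {N : DGMod A 𝒜 dA}
    (hN : Acyc N) : P N := by
  let F : Empty → DGMod A 𝒜 dA := fun e => e.elim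
  have h1 : P (coprod F) := (clr_loc hP).coprod F (fun e => e.elim)
  have h0 : ∀ x y : (coprod F).M, x = y := fun x y => DFinsupp.ext (fun e => e.elim)
  refine ((cl_of_thick hP.toIsThickClass).qis (M := coprod F) (N := N) 0 Deg.zero Cm.zero ?_).1 h1
  constructor
  · intro z hz
    obtain ⟨w, rfl⟩ := hN z hz
    exact ⟨0, -w, h0 _ _, by simp⟩
  · intro z _ _
    exact ⟨0, h0 _ _⟩

lemma loc_step {P : DGMod A 𝒜 dA → Prop} (hP : IsLocalizingClass P) {Z : DGMod A 𝒜 dA}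
    (hZ : IsHZero hA Z) (hPZ : P Z) (k : ℤ) (h : P (LD hA hn M (k + 1))) : P (LD hA hn M k) := by
  obtain ⟨u, h1, h2, h3⟩ := hd_kil hA hn (M := M) hZ
  have cl := cl_of_thick hP.toIsThickClass
  obtain ⟨X, q, a1, a2, a3, a4⟩ := kil_res hA (clr_loc hP) h1 hPZ h2 (h3 k)
  have hH : P (HD hA hn M k) := (cl.qis q a2 a3 a4).1 a1
  have hC : P (CL hA hn M k) := (cl.qis _ (prH_deg hA hn k) (prH_cm hA hn k) (prH_qis hA hn k)).2 hH
  have hd := deg_cone (incL_deg hA hn k (M := M))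
  have hc : Cm (shift (LD hA hn M (k + 1)) 1) (LD hA hn M k) (incL hA hn M k) := incL_cm hA hn k
  refine hP.ext₁ (M₁ := LD hA hn M k) (M₂ := CL hA hn M k) (M₃ := shift (LD hA hn M (k + 1)) 1)
    (bun _ (inl_deg _ _ _ hd hc) (inl_cm _ _ _ hd hc))
    (bun _ (snd_deg _ _ _ hd hc) (snd_cm _ _ _ hd hc)) ⟨?_, ?_, ?_⟩ hC (cl.shift 1 h)
  · exact LinearMap.inl_injective
  · exact LinearMap.snd_surjective
  · rintro ⟨x, y⟩
    constructor
    · intro h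
      exact ⟨x, Prod.ext rfl (show (0 : L M hA hn (k + 1)) = y from h.symm)⟩
    · rintro ⟨z, hz⟩
      exact (congrArg Prod.snd hz).symm

lemma LD_acyc (n : ℤ) (hv : ∀ i : ℤ, n ≤ i → HVanish M i) : Acyc (LD hA hn M n) := by
  intro z hz
  have hz : M.d z.1 = 0 := congrArg Subtype.val hz
  obtain ⟨w, hw, e⟩ : ∃ w ∈ U M n, M.d w = z.1 := by
    refine exists_sum_lift (C := fun z => ∃ w ∈ U M n, M.d w = z) z.1 ?_ ⟨0, zero_mem _, map_zero _⟩ ?_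
    · intro i
      by_cases hi : i < n
      · rw [z.2.1 i hi]; exact ⟨0, zero_mem _, map_zero _⟩
      · have hc : M.d (p M i z.1) = 0 := by
          have := p_d M (i - 1) z.1
          rw [sub_add_cancel] at this
          rw [← this, hz, map_zero]
        obtain ⟨w, hw, e⟩ := hv i (by omega) ⟨gp_mem M.internal i z.1, hc⟩
        exact ⟨w, U_hom hw (by omega), e⟩
    · rintro _ _ ⟨w, hw, rfl⟩ ⟨w', hw', rfl⟩
      exact ⟨w + w', add_mem hw hw', map_add _ _ _⟩
  exact ⟨⟨w, hw, by rw [e]; exact z.2.1⟩, Subtype.ext e⟩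

lemma builds_bdd (hn : ∀ i : ℤ, i < 0 → 𝒜 i = ⊥) {Z : DGMod A 𝒜 dA} (hZ : IsHZero hA Z) (hM : ∀ i : ℤ, i < 0 → M.ℳ i = ⊥) (n : ℕ)
    (hv : ∀ i : ℤ, (n : ℤ) ≤ i → HVanish M i) : Builds Z M := by
  intro P hP hPZ
  have key : ∀ j : ℕ, j ≤ n → P (LD hA hn M ((n - j : ℕ) : ℤ)) := by
    intro j
    induction j with
    | zero => intro _; exact loc_acyc hP (LD_acyc hA hn _ hv)
    | succ j ih =>
      intro hj
      refine loc_step hA hn hP hZ hPZ _ ?_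
      have := ih (by omega)
      rwa [show ((n - j : ℕ) : ℤ) = ((n - (j + 1) : ℕ) : ℤ) + 1 by omega] at this
  have h0 := key n le_rfl
  rw [Nat.sub_self] at h0
  have hU : ∀ x, x ∈ U M 0 := by
    intro x i hi
    have := gp_mem M.internal i x
    rw [hM i hi] at this
    exact AddSubgroup.mem_bot.1 this
  refine ((cl_of_thick hP.toIsThickClass).qis (L M hA hn 0).subtype
    (sub_deg M _ (L_p hA hn 0) (L_d hA hn 0)) (sub_cm M _ _ _) (Qis.of_bij ⟨?_, ?_⟩
      (sub_cm M _ _ _))).1 h0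
  · exact Subtype.val_injective
  · intro x
    exact ⟨⟨x, hU _, hU _⟩, rfl⟩

end post

theorem main (hA : IsDGAlgebra A 𝒜 dA)
    (hnonneg : ∀ i : ℤ, i < 0 → 𝒜 i = ⊥)
    (hbd : ∃ n : ℕ, ∀ i : ℤ, (n : ℤ) ≤ i → HVanish (aMod hA) i)
    (Z : DGMod A 𝒜 dA) (hZ : IsHZero hA Z) :
    IsProxySmall hA Z ↔ FinBuilds Z (aMod hA) := by
  constructor
  · rintro ⟨K, h1, h2, h3⟩
    obtain ⟨n, hv⟩ := hbd
    have hb : Builds Z (aMod hA) := builds_bdd hA hnonneg hZ hnonneg n hv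
    have h4 := fin_of_build hA h1 (fun P hP hK => hb P hP (h3 P hP hK))
    intro P hP hPZ
    exact h4 P hP (h2 P hP hPZ)
  · intro h
    refine ⟨aMod hA, fun P _ h => h, h, ?_⟩
    intro P hP hPA
    have hk : ∀ N : DGMod A 𝒜 dA, Kil (aMod hA) (oneA hA) N := by
      intro N a ha x
      have h1 : a * 1 = 0 := ha
      rw [mul_one] at h1
      rw [h1, zero_smul]
    obtain ⟨X, q, a1, a2, a3, a4⟩ := kil_res hA (clr_loc hP) (gen_one hA) hPA (hk _) (hk Z)
    exact ((cl_of_thick hP.toIsThickClass).qis q a2 a3 a4).1 a1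

end DGX
end

theorem h0_proxySmall_iff_finitely_builds_A
    (hA : IsDGAlgebra A 𝒜 dA)
    (hnonneg : ∀ i : ℤ, i < 0 → 𝒜 i = ⊥)
    (hbd : ∃ n : ℕ, ∀ i : ℤ, (n : ℤ) ≤ i → HVanish (aMod hA) i)
    (Z : DGMod A 𝒜 dA) (hZ : IsHZero hA Z) :
    IsProxySmall hA Z ↔ FinBuilds Z (aMod hA) :=
  DGX.main hA hnonneg hbd Z hZ
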